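/- Let ε ∈ {−2, 2} and let A, K be positive integers. Put a = K, b = A²K + 2εA, c = (A+1)²K + 2ε(A+1). Suppose {a, b, c, d} is a D(4)-quadruple with d > 2 such that 4d ≠ (2A² + 2A)²K³ + ε(16A³ + 24A² + 8A)K² + (80A² + 80A + 16)K + ε(32A + 16). Then A ≤ 2800 if ε = −2, and A ≤ 3365 if ε = 2. -/

import Mathlib

/-- `a, b, c, d` form a `D(4)`-quadruple: four distinct positive integers such that
the product of any two distinct elements increased by `4` is a perfect square. -/
def IsDiophQuadruple (n a b c d : ℤ) : Prop :=
  0 < a ∧ 0 < b ∧ 0 < c ∧ 0 < d ∧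
  a ≠ b ∧ a ≠ c ∧ a ≠ d ∧ b ≠ c ∧ b ≠ d ∧ c ≠ d ∧
  IsSquare (a * b + n) ∧ IsSquare (a * c + n) ∧ IsSquare (a * d + n) ∧
  IsSquare (b * c + n) ∧ IsSquare (b * d + n) ∧ IsSquare (c * d + n)

/-- The degrees chosen along a partially injective assignment sum to at least
`0 + 1 + ⋯ + (N - 1)`. -/
theorem sum_range_le_sum_degree {ι : Type*} [Fintype ι] (N : ℕ) (hN : Fintype.card ι = N)
    (f : ι → Option (Fin N)) (hf : ∀ i j p, f i = some p → f j = some p → i = j) :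
    ∑ p ∈ Finset.range N, p ≤ ∑ i, ((f i).elim N (fun p => (p : ℕ))) := by
  classical
  set g : ι → ℕ := fun i => (f i).elim N (fun p => (p : ℕ)) with hg
  set A := Finset.univ.filter (fun i => f i ≠ none) with hA
  have hlt : ∀ i ∈ A, g i < N := by
    intro i hi
    simp only [hA, Finset.mem_filter, Finset.mem_univ, true_and] at hi
    obtain ⟨p, hp⟩ := Option.ne_none_iff_exists'.mp hi
    simp [hg, hp]
  have hge : ∀ i ∈ Aᶜ, g i = N := by
    intro i hi
    simp only [hA, Finset.mem_compl, Finset.mem_filter, Finset.mem_univ, true_and, not_not] at hi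
    simp [hg, hi]
  have hinj : Set.InjOn g A := by
    intro i hi j hj hij
    simp only [hA, Finset.coe_filter, Finset.mem_univ, true_and, Set.mem_ofPred_eq] at hi hj
    obtain ⟨p, hp⟩ := Option.ne_none_iff_exists'.mp hi
    obtain ⟨q, hq⟩ := Option.ne_none_iff_exists'.mp hj
    have : p = q := by
      apply Fin.ext
      simpa [hg, hp, hq] using hij
    subst this
    exact hf i j p hp hq
  have hsub : A.image g ⊆ Finset.range N := by
    intro x hx
    obtain ⟨i, hi, rfl⟩ := Finset.mem_image.mp hx
    exact Finset.mem_range.mpr (hlt i hi)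
  have hcard : (Finset.range N \ A.image g).card = Aᶜ.card := by
    rw [Finset.card_sdiff_of_subset hsub, Finset.card_image_of_injOn hinj, Finset.card_compl,
      Finset.card_range, hN]
  calc ∑ p ∈ Finset.range N, p
      = ∑ p ∈ Finset.range N \ A.image g, p + ∑ p ∈ A.image g, p :=
        (Finset.sum_sdiff hsub).symm
    _ ≤ (Finset.range N \ A.image g).card * N + ∑ p ∈ A.image g, p := by
        gcongr
        rw [← smul_eq_mul]
        apply Finset.sum_le_card_nsmul
        intro x hx
        simp only [Finset.mem_sdiff, Finset.mem_range] at hx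
        omega
    _ = ∑ i ∈ Aᶜ, g i + ∑ i ∈ A, g i := by
        rw [Finset.sum_congr rfl hge, Finset.sum_const, smul_eq_mul, hcard,
          Finset.sum_image hinj]
    _ = ∑ i, g i := by rw [add_comm, Finset.sum_add_sum_compl]

/-- Leibniz bound for a determinant whose rows are bounded. -/
theorem abs_det_le_of_row_bound {ι : Type*} [Fintype ι] [DecidableEq ι] (M : Matrix ι ι ℝ)
    (w : ι → ℝ) (h : ∀ i j, |M i j| ≤ w i) :
    |M.det| ≤ (Fintype.card ι).factorial * ∏ i, w i := by
  rw [← Matrix.det_transpose, Matrix.det_apply]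
  refine (Finset.abs_sum_le_sum_abs _ _).trans ?_
  refine (Finset.sum_le_card_nsmul _ _ (∏ i, w i) ?_).trans ?_
  · intro σ _
    rw [Units.smul_def, zsmul_eq_mul, abs_mul, Finset.abs_prod]
    have : |((Equiv.Perm.sign σ : ℤ) : ℝ)| = 1 := by
      rcases Int.units_eq_one_or (Equiv.Perm.sign σ) with h | h <;> simp [h]
    rw [this, one_mul]
    exact Finset.prod_le_prod (fun _ _ => abs_nonneg _) fun i _ => h _ _
  · rw [Finset.card_univ, Fintype.card_perm, nsmul_eq_mul]

/-- Determinant of a matrix whose rows are combinations of `N` bounded functions with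
geometrically decaying coefficients, up to a small error. -/
theorem abs_det_le_of_geometric {ι : Type*} [Fintype ι] [DecidableEq ι] (N : ℕ)
    (hN : Fintype.card ι = N) (M : Matrix ι ι ℝ) (c : ι → Fin N → ℝ) (φ : Fin N → ι → ℝ)
    (e : ι → ι → ℝ) (hM : ∀ i j, M i j = ∑ p, c i p * φ p j + e i j)
    (hφ : ∀ p j, |φ p j| ≤ 1) (ϱ : ℝ) (hϱ : 1 ≤ ϱ) (B : ι → ℝ)
    (hc : ∀ i, ∑ p, |c i p| * ϱ ^ (p : ℕ) ≤ B i) (he : ∀ i j, |e i j| * ϱ ^ N ≤ B i) :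
    |M.det| * ϱ ^ (∑ p ∈ Finset.range N, p) ≤ N.factorial * ∏ i, (2 * B i) := by
  classical
  have hϱ0 : 0 < ϱ := by linarith
  have hB : ∀ i, 0 ≤ B i := fun i =>
    (Finset.sum_nonneg fun p _ => mul_nonneg (abs_nonneg _) (by positivity)).trans (hc i)
  let g : ι → Option (Fin N) → (ι → ℝ) := fun i o => o.elim (e i) (fun p j => c i p * φ p j)
  let w : ι → Option (Fin N) → ℝ := fun i o => o.elim (B i / ϱ ^ N) (fun p => |c i p|)
  let dg : Option (Fin N) → ℕ := fun o => o.elim N (fun p => (p : ℕ))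
  have hw0 : ∀ i o, 0 ≤ w i o := by
    intro i o
    cases o with
    | none => exact div_nonneg (hB i) (by positivity)
    | some p => exact abs_nonneg _
  have hgw : ∀ i o j, |g i o j| ≤ w i o := by
    intro i o j
    cases o with
    | none => exact (le_div_iff₀ (by positivity)).mpr (he i j)
    | some p =>
      change |c i p * φ p j| ≤ |c i p|
      rw [abs_mul]
      exact mul_le_of_le_one_right (abs_nonneg _) (hφ p j)
  have hMrow : M = fun i => ∑ o, g i o := by
    funext i j
    rw [Finset.sum_apply, Fintype.sum_option, hM, add_comm]
    rfl
  have hdet : M.det = ∑ f : ι → Option (Fin N), Matrix.det (fun i => g i (f i)) := by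
    have := (Matrix.detRowAlternating (n := ι) (R := ℝ)).toMultilinearMap.map_sum g
    rw [hMrow]
    exact this
  have hterm : ∀ f : ι → Option (Fin N),
      |Matrix.det (fun i => g i (f i))| * ϱ ^ (∑ p ∈ Finset.range N, p)
        ≤ N.factorial * ∏ i, (w i (f i) * ϱ ^ dg (f i)) := by
    intro f
    have hr0 : 0 ≤ (N.factorial : ℝ) * ∏ i, (w i (f i) * ϱ ^ dg (f i)) :=
      mul_nonneg (by positivity)
        (Finset.prod_nonneg fun i _ => mul_nonneg (hw0 _ _) (by positivity))
    by_cases hf : ∀ i j p, f i = some p → f j = some p → i = j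
    · have h1 := abs_det_le_of_row_bound (fun i => g i (f i)) (fun i => w i (f i))
        (fun i j => hgw i (f i) j)
      have h2 := sum_range_le_sum_degree N hN f hf
      rw [Finset.prod_mul_distrib, Finset.prod_pow_eq_pow_sum, ← mul_assoc]
      rw [hN] at h1
      exact mul_le_mul h1 (pow_le_pow_right₀ hϱ h2) (by positivity)
        (mul_nonneg (by positivity) (Finset.prod_nonneg fun i _ => hw0 _ _))
    · push Not at hf
      obtain ⟨i, j, p, hi, hj, hij⟩ := hf
      have hz : Matrix.det (fun i => g i (f i)) = 0 := by
        have hrow : ∀ k, f k = some p → g k (f k) = c k p • φ p := by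
          intro k hk
          rw [hk]; rfl
        set D : Matrix ι ι ℝ := fun i => g i (f i) with hD
        have e1 : D = Matrix.updateRow (Matrix.updateRow D i (c i p • φ p)) j (c j p • φ p) := by
          have h1 : c i p • φ p = D i := (hrow i hi).symm
          have h2 : c j p • φ p = D j := (hrow j hj).symm
          rw [h1, h2, Matrix.updateRow_eq_self, Matrix.updateRow_eq_self]
        rw [e1, Matrix.det_updateRow_smul, Matrix.updateRow_comm _ hij, Matrix.det_updateRow_smul]
        rw [Matrix.det_zero_of_row_eq hij]
        · simp
        · rw [Matrix.updateRow_self, Matrix.updateRow_ne hij.symm, Matrix.updateRow_self]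
      rw [hz, abs_zero, zero_mul]
      exact hr0
  calc |M.det| * ϱ ^ (∑ p ∈ Finset.range N, p)
      ≤ ∑ f : ι → Option (Fin N),
          |Matrix.det (fun i => g i (f i))| * ϱ ^ (∑ p ∈ Finset.range N, p) := by
        rw [hdet, ← Finset.sum_mul]
        gcongr
        exact Finset.abs_sum_le_sum_abs _ _
    _ ≤ ∑ f : ι → Option (Fin N), N.factorial * ∏ i, (w i (f i) * ϱ ^ dg (f i)) :=
        Finset.sum_le_sum fun f _ => hterm f
    _ = N.factorial * ∏ i, ∑ o, w i o * ϱ ^ dg o := by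
        rw [← Finset.mul_sum, Finset.prod_univ_sum, Fintype.piFinset_univ]
    _ ≤ N.factorial * ∏ i, (2 * B i) := by
        gcongr with i _
        · intro i _
          exact Finset.sum_nonneg fun o _ => mul_nonneg (hw0 _ _) (by positivity)
        · rw [Fintype.sum_option]
          have h1 : w i none * ϱ ^ dg none = B i := div_mul_cancel₀ _ (by positivity)
          have h2 : ∑ p, w i (some p) * ϱ ^ dg (some p) ≤ B i := hc i
          linarith

open Polynomial in
/-- `f` agrees on `[-1, 1]` with a Chebyshev sum of degree below `N` up to an error, with
coefficients and error of weighted size at most `B`. -/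
def ChebyshevTrunc (N : ℕ) (ϱ : ℝ) (f : ℝ → ℝ) (B : ℝ) : Prop :=
  ∃ (c : Fin N → ℝ) (e : ℝ → ℝ),
    (∀ x, |x| ≤ 1 → f x = ∑ p, c p * (Chebyshev.T ℝ (p : ℕ)).eval x + e x) ∧
    ∑ p, |c p| * ϱ ^ (p : ℕ) ≤ B ∧ ∀ x, |x| ≤ 1 → |e x| * ϱ ^ N ≤ B

namespace ChebyshevTrunc

variable {N : ℕ} {ϱ : ℝ} {f g : ℝ → ℝ} {B C : ℝ}

theorem mono (hf : ChebyshevTrunc N ϱ f B) (h : B ≤ C) : ChebyshevTrunc N ϱ f C := by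
  obtain ⟨c, e, h1, h2, h3⟩ := hf
  exact ⟨c, e, h1, h2.trans h, fun x hx => (h3 x hx).trans h⟩

theorem add (hϱ : 0 ≤ ϱ) (hf : ChebyshevTrunc N ϱ f B) (hg : ChebyshevTrunc N ϱ g C) :
    ChebyshevTrunc N ϱ (fun x => f x + g x) (B + C) := by
  obtain ⟨c, e, h1, h2, h3⟩ := hf
  obtain ⟨c', e', h1', h2', h3'⟩ := hg
  refine ⟨fun p => c p + c' p, fun x => e x + e' x, fun x hx => ?_, ?_, fun x hx => ?_⟩
  · simp only [h1 x hx, h1' x hx, add_mul, Finset.sum_add_distrib]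
    ring
  · refine le_trans ?_ (add_le_add h2 h2')
    rw [← Finset.sum_add_distrib]
    gcongr with p _
    rw [← add_mul]
    gcongr
    exact abs_add_le _ _
  · refine le_trans ?_ (add_le_add (h3 x hx) (h3' x hx))
    rw [← add_mul]
    gcongr
    exact abs_add_le _ _

theorem const_mul (a : ℝ) (hf : ChebyshevTrunc N ϱ f B) :
    ChebyshevTrunc N ϱ (fun x => a * f x) (|a| * B) := by
  obtain ⟨c, e, h1, h2, h3⟩ := hf
  refine ⟨fun p => a * c p, fun x => a * e x, fun x hx => ?_, ?_, fun x hx => ?_⟩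
  · simp only [h1 x hx, mul_add, Finset.mul_sum, mul_assoc]
  · simp only [abs_mul, mul_assoc, ← Finset.mul_sum]
    gcongr
  · rw [abs_mul, mul_assoc]
    exact mul_le_mul_of_nonneg_left (h3 x hx) (abs_nonneg _)

theorem add_small (hf : ChebyshevTrunc N ϱ f B) (hC : 0 ≤ C) (hϱ : 0 ≤ ϱ)
    (h : ∀ x, |x| ≤ 1 → |g x - f x| * ϱ ^ N ≤ C) : ChebyshevTrunc N ϱ g (B + C) := by
  obtain ⟨c, e, h1, h2, h3⟩ := hf
  refine ⟨c, fun x => e x + (g x - f x), fun x hx => ?_, by linarith, fun x hx => ?_⟩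
  · rw [← add_assoc, ← h1 x hx]; ring
  · refine le_trans ?_ (add_le_add (h3 x hx) (h x hx))
    rw [← add_mul]
    gcongr
    exact abs_add_le _ _

open Polynomial in
theorem chebyshev_nat (hϱ : 1 ≤ ϱ) (k : ℕ) :
    ChebyshevTrunc N ϱ (fun x => (Chebyshev.T ℝ (k : ℕ)).eval x) (ϱ ^ k) := by
  have h0 : 0 < ϱ := by linarith
  by_cases hk : k < N
  · refine ⟨fun p => if p = ⟨k, hk⟩ then 1 else 0, 0, fun x _ => ?_, ?_, fun x _ => ?_⟩
    · simp
    · simp [abs_ite]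
    · simp only [Pi.zero_apply, abs_zero, zero_mul]; positivity
  · refine ⟨0, fun x => (Chebyshev.T ℝ (k : ℕ)).eval x, fun x _ => by simp, ?_, fun x hx => ?_⟩
    · simp only [Pi.zero_apply, abs_zero, zero_mul, Finset.sum_const_zero]; positivity
    · calc _ ≤ 1 * ϱ ^ k := by
            gcongr
            · exact Chebyshev.abs_eval_T_real_le_one _ hx
            · omega
        _ = ϱ ^ k := one_mul _

open Polynomial in
theorem pow_mul_chebyshev (hϱ : 1 ≤ ϱ) (q : ℕ) : ∀ k : ℤ,
    ChebyshevTrunc N ϱ (fun x => x ^ q * (Chebyshev.T ℝ k).eval x)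
      ((ϱ ^ k + ϱ ^ (-k)) * ((ϱ + ϱ⁻¹) / 2) ^ q) := by
  have h0 : 0 < ϱ := by linarith
  induction q with
  | zero =>
    intro k
    simp only [pow_zero, one_mul, mul_one]
    rw [← Chebyshev.T_natAbs]
    refine (chebyshev_nat hϱ k.natAbs).mono ?_
    have h1 : 0 < ϱ ^ k := by positivity
    have h2 : 0 < ϱ ^ (-k) := by positivity
    rw [← zpow_natCast]
    rcases abs_choice k with h | h <;> rw [Int.natCast_natAbs, h] <;> linarith
  | succ q ih =>
    intro k
    have h1 := ((ih (k + 1)).add h0.le (ih (k - 1))).const_mul (1 / 2)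
    have he : (fun x : ℝ => 1 / 2 * (x ^ q * (Chebyshev.T ℝ (k + 1)).eval x
        + x ^ q * (Chebyshev.T ℝ (k - 1)).eval x))
        = fun x => x ^ (q + 1) * (Chebyshev.T ℝ k).eval x := by
      funext x
      rw [Chebyshev.T_add_one]
      simp only [eval_sub, eval_mul, eval_ofNat, eval_X]
      ring
    rw [he] at h1
    refine h1.mono (le_of_eq ?_)
    rw [show -(k + 1) = -k - 1 by ring, show -(k - 1) = -k + 1 by ring,
      zpow_add_one₀ h0.ne', zpow_add_one₀ h0.ne', zpow_sub_one₀ h0.ne', zpow_sub_one₀ h0.ne']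
    rw [abs_of_pos (by norm_num)]
    ring

theorem sum (hϱ : 0 ≤ ϱ) (F : ℕ → ℝ → ℝ) (b : ℕ → ℝ) (n : ℕ)
    (h : ∀ q, ChebyshevTrunc N ϱ (F q) (b q)) :
    ChebyshevTrunc N ϱ (fun x => ∑ q ∈ Finset.range n, F q x) (∑ q ∈ Finset.range n, b q) := by
  induction n with
  | zero => exact ⟨0, 0, by simp, by simp, by simp⟩
  | succ n ih =>
    simp only [Finset.sum_range_succ]
    exact ih.add hϱ (h n)

open Polynomial in
theorem chebyshev_mul_exp (hϱ : 1 ≤ ϱ) (k : ℕ) (c : ℝ) :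
    ChebyshevTrunc N ϱ (fun x => (Chebyshev.T ℝ (k : ℕ)).eval x * Real.exp (c * x))
      (4 * ϱ ^ k * Real.exp (|c| * ((ϱ + ϱ⁻¹) / 2))) := by
  have h0 : 0 < ϱ := by linarith
  set h := (ϱ + ϱ⁻¹) / 2 with hh
  have hh0 : 0 ≤ h := by positivity
  have hlim : Filter.Tendsto (fun n : ℕ => |c| ^ n / n.factorial * (2 * ϱ ^ N))
      Filter.atTop (nhds (0 * (2 * ϱ ^ N))) :=
    (FloorSemiring.tendsto_pow_div_factorial_atTop |c|).mul_const _
  rw [zero_mul] at hlim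
  obtain ⟨n, hn, hn2⟩ := ((hlim.eventually (gt_mem_nhds one_pos)).and
    (Filter.eventually_ge_atTop ⌈2 * |c|⌉₊)).exists
  replace hn2 : 2 * |c| ≤ n := Nat.ceil_le.mp hn2
  have hs := sum h0.le _ _ n fun q =>
    ((pow_mul_chebyshev (N := N) hϱ q (k : ℤ)).const_mul (c ^ q / q.factorial))
  have hb : ∑ q ∈ Finset.range n,
      |c ^ q / q.factorial| * ((ϱ ^ (k : ℤ) + ϱ ^ (-(k : ℤ))) * h ^ q)
        ≤ 2 * ϱ ^ k * Real.exp (|c| * h) := by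
    have h1 : ϱ ^ (k : ℤ) + ϱ ^ (-(k : ℤ)) ≤ 2 * ϱ ^ k := by
      have : ϱ ^ (-(k : ℤ)) ≤ ϱ ^ (k : ℤ) := zpow_le_zpow_right₀ hϱ (by omega)
      rw [zpow_natCast] at *
      linarith
    calc _ = (ϱ ^ (k : ℤ) + ϱ ^ (-(k : ℤ))) *
          ∑ q ∈ Finset.range n, (|c| * h) ^ q / q.factorial := by
          rw [Finset.mul_sum]
          refine Finset.sum_congr rfl fun q _ => ?_
          rw [abs_div, abs_pow, Nat.abs_cast, mul_pow]
          ring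
      _ ≤ _ := by
          gcongr
          exact Real.sum_le_exp_of_nonneg (by positivity) n
  have hs' := (hs.mono hb).add_small (g := fun x => (Chebyshev.T ℝ (k : ℕ)).eval x
    * Real.exp (c * x)) (C := 1) zero_le_one h0.le ?_
  · refine hs'.mono ?_
    have h1 : 1 ≤ ϱ ^ k := one_le_pow₀ hϱ
    have h2 : 1 ≤ Real.exp (|c| * h) := Real.one_le_exp (by positivity)
    nlinarith
  · intro x hx
    have h1 : |(Chebyshev.T ℝ (k : ℕ)).eval x| ≤ 1 := Chebyshev.abs_eval_T_real_le_one _ hx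
    have h2 : (Chebyshev.T ℝ (k : ℕ)).eval x * Real.exp (c * x)
        - ∑ q ∈ Finset.range n, c ^ q / q.factorial * (x ^ q * (Chebyshev.T ℝ (k : ℤ)).eval x)
        = (Chebyshev.T ℝ (k : ℕ)).eval x
          * (Real.exp (c * x) - ∑ q ∈ Finset.range n, (c * x) ^ q / q.factorial) := by
      rw [mul_sub, Finset.mul_sum]
      congr 1
      refine Finset.sum_congr rfl fun q _ => ?_
      rw [mul_pow]; ring
    rw [h2, abs_mul]
    have h5 : |c * x| ≤ |c| := by
      rw [abs_mul]; exact mul_le_of_le_one_right (abs_nonneg _) hx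
    have h4 : |Real.exp (c * x) - ∑ q ∈ Finset.range n, (c * x) ^ q / q.factorial|
        ≤ |c * x| ^ n / n.factorial * 2 := by
      have h3 := Complex.exp_bound' (x := (c * x : ℝ)) (n := n) (by
        rw [Complex.norm_real, Real.norm_eq_abs, div_le_div_iff₀ (by positivity) two_pos]
        push_cast
        linarith)
      rw [Complex.norm_real, Real.norm_eq_abs] at h3
      rw [← Real.norm_eq_abs, ← Complex.norm_real]
      push_cast at h3 ⊢
      exact h3
    calc _ ≤ 1 * (|c| ^ n / n.factorial * 2) * ϱ ^ N := by
          gcongr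
          exact h4.trans (by gcongr)
      _ = |c| ^ n / n.factorial * (2 * ϱ ^ N) := by ring
      _ ≤ 1 := hn.le

end ChebyshevTrunc

open Polynomial in
/-- Upper bound for the interpolation determinant at the place where the exponents are small. -/
theorem abs_det_chebyshev_exp_le {ι : Type*} [Fintype ι] [DecidableEq ι] (N : ℕ)
    (hN : Fintype.card ι = N) (k : ι → ℕ) (x : ι → ℝ) (hx : ∀ j, |x j| ≤ 1) (c : ι → ℝ)
    (y : ι → ι → ℝ) (ϱ : ℝ) (hϱ : 1 ≤ ϱ) (hy : ∀ i j, 2 * |y i j| * ϱ ^ N ≤ 1)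
    (M : Matrix ι ι ℝ)
    (hM : ∀ i j, M i j
      = (Chebyshev.T ℝ (k i : ℕ)).eval (x j) * Real.exp (c i * x j) * Real.exp (y i j)) :
    |M.det| * ϱ ^ (∑ p ∈ Finset.range N, p)
      ≤ N.factorial * ∏ i, (10 * ϱ ^ k i * Real.exp (|c i| * ((ϱ + ϱ⁻¹) / 2))) := by
  have h0 : 0 < ϱ := by linarith
  have hh : 1 ≤ (ϱ + ϱ⁻¹) / 2 := by
    have : ϱ * ϱ⁻¹ = 1 := mul_inv_cancel₀ h0.ne'
    nlinarith [sq_nonneg (ϱ - ϱ⁻¹), inv_pos.mpr h0]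
  set h := (ϱ + ϱ⁻¹) / 2
  choose a e h1 h2 h3 using fun i =>
    ChebyshevTrunc.chebyshev_mul_exp (N := N) hϱ (k i) (c i)
  have := abs_det_le_of_geometric N hN M a (fun p j => (Chebyshev.T ℝ (p : ℕ)).eval (x j))
    (fun i j => e i (x j) + (Chebyshev.T ℝ (k i : ℕ)).eval (x j) * Real.exp (c i * x j)
      * (Real.exp (y i j) - 1)) (fun i j => ?_) (fun p j => ?_) ϱ hϱ
      (fun i => 5 * ϱ ^ k i * Real.exp (|c i| * h)) (fun i => (h2 i).trans ?_) (fun i j => ?_)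
  · refine this.trans (le_of_eq ?_)
    congr 1
    refine Finset.prod_congr rfl fun i _ => ?_
    ring
  · rw [hM, ← add_assoc, ← h1 i (x j) (hx j)]; ring
  · exact Chebyshev.abs_eval_T_real_le_one _ (hx j)
  · gcongr; norm_num
  · have e1 : |Real.exp (y i j) - 1| ≤ 2 * |y i j| := by
      apply Real.abs_exp_sub_one_le
      have : 1 ≤ ϱ ^ N := one_le_pow₀ hϱ
      nlinarith [hy i j, abs_nonneg (y i j)]
    have e2 : |(Chebyshev.T ℝ (k i : ℕ)).eval (x j)| ≤ 1 :=
      Chebyshev.abs_eval_T_real_le_one _ (hx j)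
    have e3 : Real.exp (c i * x j) ≤ Real.exp (|c i| * h) := by
      apply Real.exp_le_exp.mpr
      calc c i * x j ≤ |c i| * |x j| := by rw [← abs_mul]; exact le_abs_self _
        _ ≤ |c i| * h := by gcongr; exact (hx j).trans hh
    have e4 : 1 ≤ ϱ ^ k i := one_le_pow₀ hϱ
    calc _ ≤ (|e i (x j)| + 1 * Real.exp (|c i| * h) * (2 * |y i j|)) * ϱ ^ N := by
          gcongr
          refine (abs_add_le _ _).trans ?_
          rw [abs_mul, abs_mul, Real.abs_exp]
          gcongr
      _ = |e i (x j)| * ϱ ^ N + Real.exp (|c i| * h) * (2 * |y i j| * ϱ ^ N) := by ring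
      _ ≤ 4 * ϱ ^ k i * Real.exp (|c i| * h) + Real.exp (|c i| * h) * 1 := by
          exact add_le_add (h3 i _ (hx j))
            (mul_le_mul_of_nonneg_left (hy i j) (Real.exp_pos _).le)
      _ ≤ _ := by nlinarith [Real.exp_pos (|c i| * h)]

/-- Cauchy–Schwarz for a centred weight against a permuted sequence. -/
theorem abs_sum_mul_perm_le {ι : Type*} [Fintype ι] (l r : ι → ℝ) (hl : ∑ i, l i = 0)
    (π : Equiv.Perm ι) (c : ℝ) {G : ℝ} (hG : 0 ≤ G)
    (h : (∑ i, l i ^ 2) * ∑ i, (r i - c) ^ 2 ≤ G ^ 2) : |∑ i, l i * r (π i)| ≤ G := by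
  refine abs_le_of_sq_le_sq ?_ hG
  have h1 : ∑ i, l i * r (π i) = ∑ i, l i * (r (π i) - c) := by
    simp only [mul_sub, Finset.sum_sub_distrib, ← Finset.sum_mul, hl, zero_mul, sub_zero]
  have h2 : ∑ i, (r (π i) - c) ^ 2 = ∑ i, (r i - c) ^ 2 :=
    Equiv.sum_comp π fun i => (r i - c) ^ 2
  rw [h1]
  refine (Finset.sum_mul_sq_le_sq_mul_sq _ _ _).trans ?_
  rwa [h2]

/-- Leibniz bound for a determinant of exponentials with a bilinear exponent. -/
theorem abs_det_exp_le {ι : Type*} [Fintype ι] [DecidableEq ι] (t : ι → ι → ℝ)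
    (ht : ∀ i j, |t i j| ≤ 1) (l r s : ι → ℝ) (a b Gr Gs : ℝ)
    (hr : ∀ π : Equiv.Perm ι, |∑ i, l i * r (π i)| ≤ Gr)
    (hs : ∀ π : Equiv.Perm ι, |∑ i, l i * s (π i)| ≤ Gs) (M : Matrix ι ι ℝ)
    (hM : ∀ i j, M i j = t i j * Real.exp (l i * (r j * a + s j * b))) :
    |M.det| ≤ (Fintype.card ι).factorial * Real.exp (|a| * Gr + |b| * Gs) := by
  rw [← Matrix.det_transpose, Matrix.det_apply]
  refine (Finset.abs_sum_le_sum_abs _ _).trans ?_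
  refine (Finset.sum_le_card_nsmul _ _ (Real.exp (|a| * Gr + |b| * Gs)) ?_).trans ?_
  · intro σ _
    rw [Units.smul_def, zsmul_eq_mul, abs_mul, Finset.abs_prod]
    have : |((Equiv.Perm.sign σ : ℤ) : ℝ)| = 1 := by
      rcases Int.units_eq_one_or (Equiv.Perm.sign σ) with h | h <;> simp [h]
    rw [this, one_mul]
    simp only [Matrix.transpose_apply, hM, abs_mul, Real.abs_exp, Finset.prod_mul_distrib]
    rw [← Real.exp_sum]
    have e1 : ∏ i, |t i (σ i)| ≤ 1 := Finset.prod_le_one (fun _ _ => abs_nonneg _) fun i _ => ht _ _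
    have e2 : ∑ i, l i * (r (σ i) * a + s (σ i) * b) ≤ |a| * Gr + |b| * Gs := by
      have : ∑ i, l i * (r (σ i) * a + s (σ i) * b)
          = a * (∑ i, l i * r (σ i)) + b * ∑ i, l i * s (σ i) := by
        rw [Finset.mul_sum, Finset.mul_sum, ← Finset.sum_add_distrib]
        exact Finset.sum_congr rfl fun i _ => by ring
      rw [this]
      refine (le_abs_self _).trans ((abs_add_le _ _).trans ?_)
      rw [abs_mul, abs_mul]
      gcongr
      · exact hr σ
      · exact hs σ
    calc _ ≤ 1 * Real.exp (|a| * Gr + |b| * Gs) := by gcongr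
      _ = _ := one_mul _
  · rw [Finset.card_univ, Fintype.card_perm, nsmul_eq_mul]

open Polynomial in
theorem natDegree_det_le_of_entries {q n : ℕ} (A : Matrix (Fin q) (Fin q) ℝ[X])
    (h : ∀ i j, (A i j).natDegree ≤ n) : A.det.natDegree ≤ q * n := by
  rw [Matrix.det_apply]
  refine natDegree_sum_le_of_forall_le _ _ fun σ _ => ?_
  rw [Units.smul_def]
  refine (natDegree_smul_le _ _).trans ((natDegree_prod_le _ _).trans ?_)
  refine (Finset.sum_le_card_nsmul _ _ n fun i _ => h _ _).trans ?_
  simp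

open Polynomial in
theorem coeff_det_of_entries {q n : ℕ} (A : Matrix (Fin q) (Fin q) ℝ[X])
    (h : ∀ i j, (A i j).natDegree ≤ n) :
    A.det.coeff (q * n) = (Matrix.of fun i j => (A i j).coeff n).det := by
  rw [Matrix.det_apply, Matrix.det_apply, finsetSum_coeff]
  refine Finset.sum_congr rfl fun σ _ => ?_
  rw [Units.smul_def, Units.smul_def, coeff_smul]
  congr 1
  have := coeff_prod_of_natDegree_le (Finset.univ) (fun i => A (σ i) i) n fun i _ => h _ _
  simpa using this

open Polynomial in
/-- Zero estimate for exponential polynomials on a grid. -/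
theorem eq_zero_of_vanish_on_grid (n L R S m : ℕ) (F : Fin L → ℝ[X])
    (hdeg : ∀ l, (F l).natDegree ≤ n) (C₀ θ : ℝ) (hC : C₀ ≠ 0) (hθ : 1 < θ) (hSm : S ≤ m)
    (hLS : L ≤ S) (hcount : L * n < R * (S - L + 1))
    (hF : ∀ r < R, ∀ s < S,
      ∑ l, (F l).eval ((r * m + s : ℕ) : ℝ) * (C₀ ^ r * θ ^ s) ^ (l : ℕ) = 0) :
    F = 0 := by
  classical
  by_contra hF0
  set Λ : Finset (Fin L) := Finset.univ.filter (fun l => F l ≠ 0) with hΛ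
  have hΛne : Λ.Nonempty := by
    by_contra hne
    apply hF0
    funext l
    by_contra hl
    exact hne ⟨l, by simpa [hΛ] using hl⟩
  obtain ⟨q, hq⟩ : ∃ q, q = Λ.card := ⟨_, rfl⟩
  have hqpos : 0 < q := hq ▸ hΛne.card_pos
  have hqL : q ≤ L := by
    rw [hq]; exact (Finset.card_le_univ _).trans (by simp)
  let e : Fin q ↪o Fin L := Λ.orderEmbOfFin hq.symm
  have he : ∀ i, F (e i) ≠ 0 := fun i => by
    have := Finset.orderEmbOfFin_mem Λ hq.symm i
    exact (Finset.mem_filter.mp this).2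
  have hθ0 : 0 < θ := by linarith
  let v : Fin q → ℝ := fun i => θ ^ (e i : ℕ)
  have hv : Function.Injective v := by
    intro i j hij
    have := pow_right_injective₀ hθ0 hθ.ne' hij
    exact e.injective (Fin.ext this)
  let A : Matrix (Fin q) (Fin q) ℝ[X] := fun σ i =>
    C (v i ^ (σ : ℕ)) * (F (e i)).comp (X + C (σ : ℝ)) * X ^ (n - (F (e i)).natDegree)
  have hAdeg : ∀ σ i, (A σ i).natDegree ≤ n := by
    intro σ i
    refine natDegree_mul_le.trans ?_
    have h1 := natDegree_C_mul_le (v i ^ (σ : ℕ)) ((F (e i)).comp (X + C (σ : ℝ)))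
    rw [natDegree_comp, natDegree_X_add_C, mul_one] at h1
    rw [natDegree_X_pow]
    have := hdeg (e i)
    omega
  have hAcoeff : ∀ σ i, (A σ i).coeff n = (F (e i)).leadingCoeff * v i ^ (σ : ℕ) := by
    intro σ i
    have h1 : ((F (e i)).comp (X + C (σ : ℝ))).natDegree = (F (e i)).natDegree := by
      rw [natDegree_comp, natDegree_X_add_C, mul_one]
    have h2 : ((F (e i)).comp (X + C (σ : ℝ))).leadingCoeff = (F (e i)).leadingCoeff := by
      rw [leadingCoeff_comp (by rw [natDegree_X_add_C]; exact one_ne_zero),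
        leadingCoeff_X_add_C, one_pow, mul_one]
    have h3 := hdeg (e i)
    change (C (v i ^ (σ : ℕ)) * (F (e i)).comp (X + C (σ : ℝ))
      * X ^ (n - (F (e i)).natDegree)).coeff n = _
    rw [mul_assoc, coeff_C_mul, coeff_mul_X_pow']
    rw [if_pos (by omega), show n - (n - (F (e i)).natDegree) = (F (e i)).natDegree by omega,
      ← h1, coeff_natDegree, h2, mul_comm]
  have hD0 : A.det ≠ 0 := by
    intro h0
    have h1 := coeff_det_of_entries A hAdeg
    rw [h0, coeff_zero] at h1
    have h2 : (Matrix.of fun i j => (A i j).coeff n)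
        = Matrix.of fun i j => (F (e j)).leadingCoeff * (Matrix.vandermonde v).transpose i j := by
      ext i j
      simp only [Matrix.of_apply, hAcoeff, Matrix.transpose_apply, Matrix.vandermonde_apply]
    rw [h2, Matrix.det_mul_row, Matrix.det_transpose] at h1
    have h3 : (Matrix.vandermonde v).det ≠ 0 := Matrix.det_vandermonde_ne_zero_iff.mpr hv
    have h4 : ∏ i, (F (e i)).leadingCoeff ≠ 0 :=
      Finset.prod_ne_zero_iff.mpr fun i _ => leadingCoeff_ne_zero.mpr (he i)
    exact mul_ne_zero h4 h3 h1.symm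
  apply hD0
  refine eq_zero_of_natDegree_lt_card_of_eval_eq_zero A.det
    (f := fun x : Fin R × Fin (S - L + 1) => ((x.1 * m + x.2 : ℕ) : ℝ)) ?_ ?_ ?_
  · intro x y hxy
    have hxy' : (x.1 * m + x.2 : ℕ) = y.1 * m + y.2 := Nat.cast_injective (R := ℝ) hxy
    have hx2 : (x.2 : ℕ) < m := by have := x.2.2; omega
    have hy2 : (y.2 : ℕ) < m := by have := y.2.2; omega
    have h1 : (x.1 : ℕ) = y.1 := by
      have ha := congrArg (· / m) hxy'
      have hm : 0 < m := by omega
      simpa [Nat.mul_add_div hm, mul_comm _ m, Nat.div_eq_of_lt hx2, Nat.div_eq_of_lt hy2]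
        using ha
    rw [h1] at hxy'
    exact Prod.ext (Fin.ext h1) (Fin.ext (by omega))
  · intro x
    set z : ℝ := ((x.1 * m + x.2 : ℕ) : ℝ) with hz
    have h1 : A.det.eval z = (A.map (eval z)).det := by
      rw [← coe_evalRingHom, RingHom.map_det]; rfl
    have h2 : A.map (eval z) = Matrix.of fun σ i => z ^ (n - (F (e i)).natDegree)
        * (Matrix.of fun (σ i : Fin q) => v i ^ (σ : ℕ) * (F (e i)).eval (z + σ)) σ i := by
      ext σ i
      change (C (v i ^ (σ : ℕ)) * (F (e i)).comp (X + C (σ : ℝ))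
        * X ^ (n - (F (e i)).natDegree)).eval z = _
      simp only [eval_mul, eval_C, eval_pow, eval_X, eval_comp, eval_add, Matrix.of_apply]
      ring
    rw [h1, h2, Matrix.det_mul_row]
    apply mul_eq_zero_of_right
    rw [← Matrix.exists_mulVec_eq_zero_iff]
    refine ⟨fun i => (C₀ ^ (x.1 : ℕ) * θ ^ (x.2 : ℕ)) ^ (e i : ℕ), fun h0 => ?_, ?_⟩
    · have := congrFun h0 ⟨0, hqpos⟩
      have hpos : C₀ ^ (x.1 : ℕ) * θ ^ (x.2 : ℕ) ≠ 0 := by positivity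
      exact pow_ne_zero _ hpos this
    · funext σ
      have hx2 := x.2.2
      have hσ := σ.2
      have h3 := hF x.1 x.1.2 (x.2 + σ) (by omega)
      rw [← Finset.sum_subset (Finset.subset_univ Λ)] at h3
      · rw [Pi.zero_apply, ← h3]
        have h4 : Finset.univ.map e.toEmbedding = Λ := by
          ext y
          rw [Finset.mem_map]
          have := Finset.range_orderEmbOfFin Λ hq.symm
          rw [← Finset.mem_coe (s := Λ), ← this]
          simp [e, -Finset.range_orderEmbOfFin]
        rw [← h4, Finset.sum_map, Matrix.mulVec, dotProduct]
        refine Finset.sum_congr rfl fun i _ => ?_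
        simp only [Matrix.of_apply, v, RelEmbedding.coe_toEmbedding]
        rw [show (z + σ : ℝ) = ((x.1 * m + (x.2 + σ) : ℕ) : ℝ) by rw [hz]; push_cast; ring]
        ring
      · intro l _ hl
        have : F l = 0 := by simpa [hΛ] using hl
        simp [this]
  · rw [Fintype.card_prod, Fintype.card_fin, Fintype.card_fin]
    calc _ ≤ q * n := natDegree_det_le_of_entries A hAdeg
      _ ≤ L * n := Nat.mul_le_mul_right _ hqL
      _ < _ := hcount

/-- If the columns of a tall matrix are independent, some square submatrix is invertible. -/
theorem exists_det_submatrix_ne_zero {ι κ : Type*} [Fintype ι] [DecidableEq ι]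
    (A : κ → ι → ℝ) (h : ∀ a : ι → ℝ, (∀ g, ∑ i, a i * A g i = 0) → a = 0) :
    ∃ j : ι → κ, Function.Injective j ∧ (Matrix.of fun i i' => A (j i') i).det ≠ 0 := by
  classical
  have hspan : Submodule.span ℝ (Set.range A) = ⊤ := by
    by_contra hne
    obtain ⟨f, hf0, hf⟩ := Submodule.exists_le_ker_of_lt_top _ (lt_top_iff_ne_top.mpr hne)
    apply hf0
    have h1 : (fun i => f (Pi.single i 1)) = 0 := by
      apply h
      intro g
      have h2 : A g ∈ LinearMap.ker f := hf (Submodule.subset_span ⟨g, rfl⟩)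
      rw [LinearMap.mem_ker, LinearMap.pi_apply_eq_sum_univ] at h2
      rw [← h2]
      refine Finset.sum_congr rfl fun i _ => ?_
      rw [smul_eq_mul, mul_comm]
      congr 2
      funext k
      simp [Pi.single_apply, eq_comm]
    refine LinearMap.pi_ext' fun i => LinearMap.ext_ring ?_
    simpa using congrFun h1 i
  obtain ⟨τ, a, ha, hsp, hli⟩ := exists_linearIndependent' ℝ A
  let b := Module.Basis.mk hli (by rw [hsp, hspan])
  let e : ι ≃ τ := (Pi.basisFun ℝ ι).indexEquiv b
  refine ⟨fun i => a (e i), ha.comp e.injective, ?_⟩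
  have hrow : LinearIndependent ℝ (fun i => A (a (e i))) := hli.comp e e.injective
  have := Matrix.linearIndependent_rows_iff_isUnit (A := Matrix.of fun i => A (a (e i)))
  have hu := this.mp hrow
  rw [Matrix.isUnit_iff_isUnit_det] at hu
  have h2 := hu.ne_zero
  rw [← Matrix.det_transpose] at h2
  exact h2

open Polynomial in
theorem det_polynomial_basis {P L : ℕ} (p : Fin P → ℝ[X])
    (hdeg : ∀ k, (p k).natDegree ≤ k) (z : Fin P × Fin L → ℝ)
    (w : Fin L → Fin P × Fin L → ℝ) :
    (Matrix.of fun i j => (p i.1).eval (z j) * w i.2 j).det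
      = (∏ k, (p k).coeff k) ^ L
        * (Matrix.of fun (i : Fin P × Fin L) j => z j ^ (i.1 : ℕ) * w i.2 j).det := by
  classical
  set A : Matrix (Fin P) (Fin P) ℝ := Matrix.of fun k k' => (p k).coeff k' with hA
  have h1 : (Matrix.of fun i j => (p i.1).eval (z j) * w i.2 j)
      = Matrix.kronecker A (1 : Matrix (Fin L) (Fin L) ℝ)
        * (Matrix.of fun (i : Fin P × Fin L) j => z j ^ (i.1 : ℕ) * w i.2 j) := by
    ext i j
    rw [Matrix.mul_apply, Fintype.sum_prod_type]
    simp only [Matrix.of_apply, Matrix.kronecker, Matrix.kroneckerMap_apply, Matrix.one_apply]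
    simp only [mul_ite, mul_one, mul_zero, ite_mul, zero_mul, Finset.sum_ite_eq, Finset.mem_univ,
      if_true, hA, Matrix.of_apply]
    rw [eval_eq_sum_range' (n := P) (by have := hdeg i.1; omega), Finset.sum_range,
      Finset.sum_mul]
    exact Finset.sum_congr rfl fun k _ => by ring
  have h2 : A.det = ∏ k, (p k).coeff k := by
    rw [Matrix.det_of_isLowerTriangular]
    · rfl
    · intro i j hij
      exact coeff_eq_zero_of_natDegree_lt ((hdeg i).trans_lt hij)
  rw [h1, Matrix.det_mul, Matrix.kronecker, Matrix.det_kronecker, h2]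
  simp

open Polynomial in
theorem det_choose_eq_det_pow {P L : ℕ} (z : Fin P × Fin L → ℕ)
    (w : Fin L → Fin P × Fin L → ℝ) :
    (Matrix.of fun (i : Fin P × Fin L) j => ((z j).choose i.1 : ℝ) * w i.2 j).det
      = (∏ k : Fin P, ((k : ℕ).factorial : ℝ)⁻¹) ^ L
        * (Matrix.of fun (i : Fin P × Fin L) j => (z j : ℝ) ^ (i.1 : ℕ) * w i.2 j).det := by
  have hb := det_polynomial_basis (P := P) (L := L)
    (fun k => C ((k : ℕ).factorial : ℝ)⁻¹ * descPochhammer ℝ k) (fun k => by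
      refine (natDegree_C_mul_le _ _).trans ?_
      rw [descPochhammer_natDegree]) (fun j => (z j : ℝ)) w
  have hb1 : ∀ k : Fin P, (C ((k : ℕ).factorial : ℝ)⁻¹ * descPochhammer ℝ k).coeff k
      = ((k : ℕ).factorial : ℝ)⁻¹ := by
    intro k
    have : (descPochhammer ℝ k).coeff k = 1 := by
      have h := (monic_descPochhammer ℝ k).coeff_natDegree
      rwa [descPochhammer_natDegree] at h
    rw [coeff_C_mul, this, mul_one]
  have hb2 : (Matrix.of fun (i : Fin P × Fin L) j => ((z j).choose i.1 : ℝ) * w i.2 j)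
      = Matrix.of fun (i : Fin P × Fin L) j =>
        (C ((i.1 : ℕ).factorial : ℝ)⁻¹ * descPochhammer ℝ i.1).eval (z j : ℝ) * w i.2 j := by
    ext i j
    rw [Matrix.of_apply, Matrix.of_apply, eval_C_mul, descPochhammer_eval_eq_descFactorial,
      Nat.descFactorial_eq_factorial_mul_choose]
    push_cast
    rw [inv_mul_cancel_left₀ (by positivity)]
  rw [hb2, hb]
  simp only [hb1]

open Polynomial in
/-- Passing from binomial coefficients to Chebyshev polynomials in a rescaled variable. -/
theorem abs_det_choose_le_chebyshev {P L : ℕ} (z : Fin P × Fin L → ℕ) (c T : ℝ) (hT : 0 < T)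
    (w : Fin L → Fin P × Fin L → ℝ) :
    |(Matrix.of fun (i : Fin P × Fin L) j => ((z j).choose i.1 : ℝ) * w i.2 j).det|
      ≤ (∏ k : Fin P, (2 * (T / 2) ^ (k : ℕ) / (k : ℕ).factorial)) ^ L
        * |(Matrix.of fun (i : Fin P × Fin L) j =>
            (Chebyshev.T ℝ ((i.1 : ℕ) : ℤ)).eval ((z j - c) / T) * w i.2 j).det| := by
  have hc := det_polynomial_basis (P := P) (L := L)
    (fun k => (Chebyshev.T ℝ ((k : ℕ) : ℤ)).comp (C T⁻¹ * (X - C c))) (fun k => by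
      rw [natDegree_comp, Chebyshev.natDegree_T, natDegree_C_mul (by positivity),
        natDegree_X_sub_C]
      simp) (fun j => (z j : ℝ)) w
  have hc1 : ∀ k : Fin P, ((Chebyshev.T ℝ ((k : ℕ) : ℤ)).comp (C T⁻¹ * (X - C c))).coeff k
      = 2 ^ ((k : ℕ) - 1) * T⁻¹ ^ (k : ℕ) := by
    intro k
    have hd : (C T⁻¹ * (X - C c)).natDegree = 1 := by
      rw [natDegree_C_mul (by positivity), natDegree_X_sub_C]
    have h := leadingCoeff_comp (p := Chebyshev.T ℝ ((k : ℕ) : ℤ)) (q := C T⁻¹ * (X - C c))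
      (by rw [hd]; exact one_ne_zero)
    rw [leadingCoeff, natDegree_comp, hd, Chebyshev.natDegree_T, Chebyshev.leadingCoeff_T,
      leadingCoeff_mul, leadingCoeff_C, leadingCoeff_X_sub_C, mul_one, mul_one,
      Int.natAbs_natCast] at h
    exact h
  have hc2 : (Matrix.of fun (i : Fin P × Fin L) j =>
        (Chebyshev.T ℝ ((i.1 : ℕ) : ℤ)).eval ((z j - c) / T) * w i.2 j)
      = Matrix.of fun (i : Fin P × Fin L) j =>
        ((Chebyshev.T ℝ ((i.1 : ℕ) : ℤ)).comp (C T⁻¹ * (X - C c))).eval (z j : ℝ)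
          * w i.2 j := by
    ext i j
    rw [Matrix.of_apply, Matrix.of_apply, eval_comp, eval_C_mul, eval_sub, eval_X, eval_C,
      div_eq_inv_mul]
  rw [det_choose_eq_det_pow, hc2, hc]
  simp only [hc1]
  rw [abs_mul, abs_mul, ← mul_assoc]
  gcongr
  rw [abs_pow, abs_pow, ← mul_pow, Finset.abs_prod, Finset.abs_prod, ← Finset.prod_mul_distrib]
  gcongr with k _
  rw [abs_of_pos (by positivity), abs_of_pos (by positivity)]
  have hT' : (T / 2) ^ (k : ℕ) * T⁻¹ ^ (k : ℕ) * 2 ^ (k : ℕ) = 1 := by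
    rw [← mul_pow, ← mul_pow]
    have : T / 2 * T⁻¹ * 2 = 1 := by field_simp
    rw [this, one_pow]
  have h2 : (2 : ℝ) ^ (k : ℕ) ≤ 2 * 2 ^ ((k : ℕ) - 1) := by
    rw [← pow_succ']
    exact pow_le_pow_right₀ one_le_two (by omega)
  have hf : (0 : ℝ) < ((k : ℕ).factorial : ℝ) := by positivity
  rw [div_mul_eq_mul_div, inv_eq_one_div]
  gcongr
  calc (1 : ℝ) = (T / 2) ^ (k : ℕ) * T⁻¹ ^ (k : ℕ) * 2 ^ (k : ℕ) := hT'.symm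
    _ ≤ (T / 2) ^ (k : ℕ) * T⁻¹ ^ (k : ℕ) * (2 * 2 ^ ((k : ℕ) - 1)) := by gcongr
    _ = _ := by ring

theorem eq_zero_of_sq_eq_mul_sq {D p u : ℤ} (hD : ¬ IsSquare D) (h : p ^ 2 = D * u ^ 2) :
    p = 0 ∧ u = 0 := by
  have hu : u = 0 := by
    by_contra hu
    have hdvd : u ^ 2 ∣ p ^ 2 := ⟨D, by rw [h]; ring⟩
    rw [Int.pow_dvd_pow_iff two_ne_zero] at hdvd
    obtain ⟨k, rfl⟩ := hdvd
    apply hD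
    refine ⟨k, ?_⟩
    have : u ^ 2 * (k * k) = u ^ 2 * D := by linear_combination h
    exact (mul_left_cancel₀ (pow_ne_zero 2 hu) this).symm
  subst hu
  refine ⟨?_, rfl⟩
  simpa using h

theorem eq_zero_of_add_mul_sqrt {D p u : ℤ} (hD : ¬ IsSquare D) {x : ℝ} (hx : x ^ 2 = D)
    (h : (p : ℝ) + u * x = 0) : p = 0 ∧ u = 0 := by
  apply eq_zero_of_sq_eq_mul_sq hD
  have : (p : ℝ) ^ 2 = D * (u : ℝ) ^ 2 := by
    rw [← hx, eq_neg_of_add_eq_zero_left h]; ring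
  exact_mod_cast this

theorem eq_zero_of_biquadratic {D₁ D₂ p q u w : ℤ} (h₁ : ¬ IsSquare D₁) (h₂ : ¬ IsSquare D₂)
    (h₁₂ : ¬ IsSquare (D₁ * D₂)) {x y : ℝ} (hx : x ^ 2 = D₁) (hy : y ^ 2 = D₂)
    (h : (p : ℝ) + q * x + u * y + w * x * y = 0) : p = 0 ∧ q = 0 ∧ u = 0 ∧ w = 0 := by
  have hs : ((p ^ 2 + q ^ 2 * D₁ - D₂ * (u ^ 2 + w ^ 2 * D₁) : ℤ) : ℝ)
      + ((2 * (p * q - D₂ * u * w) : ℤ) : ℝ) * x = 0 := by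
    push_cast
    rw [← hx, ← hy]
    linear_combination (p + q * x - u * y - w * x * y) * h
  obtain ⟨ha, hb⟩ := eq_zero_of_add_mul_sqrt h₁ hx hs
  have hb' : p * q - D₂ * u * w = 0 := by linarith
  have hprod : (p ^ 2 - D₂ * u ^ 2) * (p ^ 2 - D₁ * D₂ * w ^ 2) = 0 := by
    linear_combination p ^ 2 * ha - D₁ * (p * q + D₂ * u * w) * hb'
  have hD₁ : D₁ ≠ 0 := by rintro rfl; exact h₁ (IsSquare.zero)
  rcases mul_eq_zero.mp hprod with h0 | h0
  · obtain ⟨rfl, rfl⟩ := eq_zero_of_sq_eq_mul_sq h₂ (sub_eq_zero.mp h0)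
    have : q ^ 2 = D₂ * w ^ 2 := by
      apply mul_left_cancel₀ hD₁
      linear_combination ha
    obtain ⟨rfl, rfl⟩ := eq_zero_of_sq_eq_mul_sq h₂ this
    simp
  · obtain ⟨rfl, rfl⟩ := eq_zero_of_sq_eq_mul_sq h₁₂ (sub_eq_zero.mp h0)
    have : (q * D₁) ^ 2 = D₁ * D₂ * u ^ 2 := by
      linear_combination D₁ * ha
    obtain ⟨h3, rfl⟩ := eq_zero_of_sq_eq_mul_sq h₁₂ this
    rcases mul_eq_zero.mp h3 with rfl | h3
    · simp
    · exact absurd h3 hD₁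

/-- Conjugate pairs of units of two quadratic orders, with the field they generate of degree `4`. -/
structure BiquadraticUnits (r s : ℤ) (α β : Bool → ℝ) : Prop where
  add_left : α true + α false = r
  mul_left : α true * α false = 1
  add_right : β true + β false = s
  mul_right : β true * β false = 1
  not_isSquare_left : ¬ IsSquare (r ^ 2 - 4)
  not_isSquare_right : ¬ IsSquare (s ^ 2 - 4)
  not_isSquare_mul : ¬ IsSquare ((r ^ 2 - 4) * (s ^ 2 - 4))

namespace BiquadraticUnits

variable {r s : ℤ} {α β : Bool → ℝ}

theorem sq_left (h : BiquadraticUnits r s α β) (i : Bool) : α i ^ 2 - r * α i + 1 = 0 := by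
  have h1 := h.add_left
  have h2 := h.mul_left
  cases i <;> rw [← h1, ← h2] <;> ring

theorem sq_right (h : BiquadraticUnits r s α β) (i : Bool) : β i ^ 2 - s * β i + 1 = 0 := by
  have h1 := h.add_right
  have h2 := h.mul_right
  cases i <;> rw [← h1, ← h2] <;> ring

/-- The order `ℤ[α, β]`, through its four real embeddings. -/
def order (h : BiquadraticUnits r s α β) : Subring (Bool × Bool → ℝ) where
  carrier := {f | ∃ p q u w : ℤ, ∀ i, f i = p + q * α i.1 + u * β i.2 + w * α i.1 * β i.2}
  zero_mem' := ⟨0, 0, 0, 0, fun i => by simp⟩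
  one_mem' := ⟨1, 0, 0, 0, fun i => by simp⟩
  neg_mem' := by
    rintro f ⟨p, q, u, w, hf⟩
    refine ⟨-p, -q, -u, -w, fun i => ?_⟩
    rw [Pi.neg_apply, hf]; push_cast; ring
  add_mem' := by
    rintro f g ⟨p, q, u, w, hf⟩ ⟨p', q', u', w', hg⟩
    refine ⟨p + p', q + q', u + u', w + w', fun i => ?_⟩
    rw [Pi.add_apply, hf, hg]; push_cast; ring
  mul_mem' := by
    rintro f g ⟨p, q, u, w, hf⟩ ⟨p', q', u', w', hg⟩
    refine ⟨p * p' - u * u' - (q * q' - w * w'),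
      p * q' + q * p' - (u * w' + w * u') + r * (q * q' - w * w'),
      p * u' + u * p' + s * (u * u') - (q * w' + w * q' + s * (w * w')),
      p * w' + u * q' + q * u' + w * p' + s * (u * w' + w * u')
        + r * (q * w' + w * q' + s * (w * w')), fun i => ?_⟩
    have h1 := h.sq_left i.1
    have h2 := h.sq_right i.2
    rw [Pi.mul_apply, hf, hg]; push_cast
    linear_combination (q + w * β i.2) * (q' + w' * β i.2) * h1
      + (u * u' - w * w' + α i.1 * (u * w' + w * u' + r * (w * w'))) * h2

theorem left_mem (h : BiquadraticUnits r s α β) : (fun i => α i.1) ∈ h.order :=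
  ⟨0, 1, 0, 0, fun i => by simp⟩

theorem right_mem (h : BiquadraticUnits r s α β) : (fun i => β i.2) ∈ h.order :=
  ⟨0, 0, 1, 0, fun i => by simp⟩

theorem left_inv_mem (h : BiquadraticUnits r s α β) : (fun i => (α i.1)⁻¹) ∈ h.order := by
  refine ⟨r, -1, 0, 0, fun i => ?_⟩
  have h1 := h.sq_left i.1
  have h0 : α i.1 ≠ 0 := by
    intro h0; rw [h0] at h1; norm_num at h1
  push_cast
  rw [inv_eq_iff_eq_inv, ← mul_eq_one_iff_eq_inv₀]
  · linear_combination -h1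
  · intro h2
    have : α i.1 * (r - α i.1) = 0 := mul_eq_zero_of_right _ (by linear_combination h2)
    have : (1 : ℝ) = 0 := by linear_combination h1 + this
    norm_num at this

theorem right_inv_mem (h : BiquadraticUnits r s α β) : (fun i => (β i.2)⁻¹) ∈ h.order := by
  refine ⟨s, 0, -1, 0, fun i => ?_⟩
  have h1 := h.sq_right i.2
  push_cast
  rw [inv_eq_iff_eq_inv, ← mul_eq_one_iff_eq_inv₀]
  · linear_combination -h1
  · intro h2
    have : β i.2 * (s - β i.2) = 0 := mul_eq_zero_of_right _ (by linear_combination h2)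
    have : (1 : ℝ) = 0 := by linear_combination h1 + this
    norm_num at this

theorem zpow_left_mem (h : BiquadraticUnits r s α β) (n : ℤ) :
    (fun i => α i.1 ^ n) ∈ h.order := by
  rcases n with n | n
  · have := h.order.pow_mem h.left_mem n
    convert this using 1
    funext i; simp
  · have := h.order.pow_mem h.left_inv_mem (n + 1)
    convert this using 1
    funext i; simp [zpow_negSucc]

theorem zpow_right_mem (h : BiquadraticUnits r s α β) (n : ℤ) :
    (fun i => β i.2 ^ n) ∈ h.order := by
  rcases n with n | n
  · have := h.order.pow_mem h.right_mem n
    convert this using 1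
    funext i; simp
  · have := h.order.pow_mem h.right_inv_mem (n + 1)
    convert this using 1
    funext i; simp [zpow_negSucc]

/-- The norm of a nonzero element of the order has absolute value at least `1`. -/
theorem one_le_prod_abs (h : BiquadraticUnits r s α β) {f : Bool × Bool → ℝ}
    (hf : f ∈ h.order) (i₀ : Bool × Bool) (h0 : f i₀ ≠ 0) : 1 ≤ ∏ i, |f i| := by
  obtain ⟨p, q, u, w, hf⟩ := hf
  have hne : ∀ i, f i ≠ 0 := by
    intro i hi
    rw [hf] at hi
    have h1 := h.sq_left i.1
    have h2 := h.sq_right i.2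
    have hx : (2 * α i.1 - r) ^ 2 = ((r ^ 2 - 4 : ℤ) : ℝ) := by
      push_cast; linear_combination 4 * h1
    have hy : (2 * β i.2 - s) ^ 2 = ((s ^ 2 - 4 : ℤ) : ℝ) := by
      push_cast; linear_combination 4 * h2
    have := eq_zero_of_biquadratic h.not_isSquare_left h.not_isSquare_right h.not_isSquare_mul
      hx hy (p := 4 * p + 2 * q * r + 2 * u * s + w * r * s) (q := 2 * q + w * s)
      (u := 2 * u + w * r) (w := w) (by push_cast; linear_combination 4 * hi)
    obtain ⟨e1, e2, e3, rfl⟩ := this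
    have hq : q = 0 := by linarith
    have hu : u = 0 := by linarith
    subst hq hu
    have hp : p = 0 := by linarith
    subst hp
    apply h0
    rw [hf]; simp
  set A : ℤ := p ^ 2 - u ^ 2 + r * (p * q - u * w) + q ^ 2 - w ^ 2 with hA
  set B : ℤ := 2 * p * u + s * u ^ 2 + r * (p * w + u * q + s * (u * w)) + 2 * q * w + s * w ^ 2
    with hB
  have hpair : ∀ j, f (true, j) * f (false, j) = A + B * β j := by
    intro j
    have h1 := h.add_left
    have h2 := h.mul_left
    have h3 := h.sq_right j
    rw [hf, hf]
    simp only
    have : ((p : ℝ) + q * α true + u * β j + w * α true * β j)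
        * (p + q * α false + u * β j + w * α false * β j)
        = (p + u * β j) ^ 2 + (p + u * β j) * (q + w * β j) * (α true + α false)
          + (q + w * β j) ^ 2 * (α true * α false) := by ring
    rw [this, h1, h2, hA, hB]
    push_cast
    linear_combination ((u : ℝ) ^ 2 + u * w * r + w ^ 2) * h3
  have hint : ∏ i, f i = ((A ^ 2 + s * (A * B) + B ^ 2 : ℤ) : ℝ) := by
    rw [Fintype.prod_prod_type_right]
    simp only [Fintype.prod_bool, hpair]
    have h1 := h.add_right
    have h2 := h.mul_right
    push_cast
    rw [← h1]
    linear_combination (B : ℝ) ^ 2 * h2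
  rw [← Finset.abs_prod, hint, ← Int.cast_abs]
  have : A ^ 2 + s * (A * B) + B ^ 2 ≠ 0 := by
    intro h3
    rw [h3, Int.cast_zero] at hint
    exact Finset.prod_ne_zero_iff.mpr (fun i _ => hne i) hint
  exact_mod_cast Int.one_le_abs this

end BiquadraticUnits

theorem det_choose_ne_zero {P L : ℕ} (z : Fin P × Fin L → ℕ) (w : Fin L → Fin P × Fin L → ℝ)
    (h : (Matrix.of fun (i : Fin P × Fin L) j => (z j : ℝ) ^ (i.1 : ℕ) * w i.2 j).det ≠ 0) :
    (Matrix.of fun (i : Fin P × Fin L) j => ((z j).choose i.1 : ℝ) * w i.2 j).det ≠ 0 := by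
  rw [det_choose_eq_det_pow]
  exact mul_ne_zero (pow_ne_zero _ (Finset.prod_ne_zero_iff.mpr fun k _ => by positivity)) h

open Polynomial in
/-- A set of grid points at which the interpolation determinant does not vanish. -/
theorem exists_grid_det_ne_zero (P R S m : ℕ) (C₀ θ : ℝ) (hC : 0 < C₀) (hθ : 1 < θ)
    (hSm : S ≤ m) (hLS : 11 ≤ S) (hcount : 11 * (P - 1) < R * (S - 11 + 1)) :
    ∃ j : Fin P × Fin 11 → Fin R × Fin S, Function.Injective j ∧
      (Matrix.of fun (i : Fin P × Fin 11) i' =>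
        ((((j i').1 * m + (j i').2 : ℕ)).choose i.1 : ℝ)
          * (C₀ ^ ((j i').1 : ℕ) * θ ^ ((j i').2 : ℕ)) ^ (((i.2 : ℕ) : ℤ) - 5)).det ≠ 0 := by
  have hθ0 : 0 < θ := by linarith
  obtain ⟨j, hj, hdet⟩ := exists_det_submatrix_ne_zero
    (fun (g : Fin R × Fin S) (i : Fin P × Fin 11) => ((g.1 * m + g.2 : ℕ) : ℝ) ^ (i.1 : ℕ)
      * (C₀ ^ (g.1 : ℕ) * θ ^ (g.2 : ℕ)) ^ (((i.2 : ℕ) : ℤ) - 5)) (by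
    intro a ha
    have hF := eq_zero_of_vanish_on_grid (P - 1) 11 R S m
      (fun l => ∑ k : Fin P, C (a (k, l)) * X ^ (k : ℕ)) (fun l => by
        refine natDegree_sum_le_of_forall_le _ _ fun k _ => ?_
        exact (natDegree_C_mul_X_pow_le _ _).trans (by omega)) C₀ θ hC.ne' hθ hSm hLS hcount (by
        intro r hr s hs
        have hne : C₀ ^ r * θ ^ s ≠ 0 := by positivity
        have h1 := ha (⟨r, hr⟩, ⟨s, hs⟩)
        have h2 := congrArg (· * (C₀ ^ r * θ ^ s) ^ (5 : ℕ)) h1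
        simp only [zero_mul, Finset.sum_mul] at h2
        rw [Fintype.sum_prod_type_right] at h2
        rw [← h2]
        refine Finset.sum_congr rfl fun l _ => ?_
        rw [eval_finsetSum, Finset.sum_mul]
        refine Finset.sum_congr rfl fun k _ => ?_
        rw [zpow_sub₀ hne, zpow_natCast, zpow_ofNat]
        simp only [eval_mul, eval_C, eval_pow, eval_X]
        have h5 : (C₀ ^ r * θ ^ s) ^ 5 ≠ 0 := pow_ne_zero _ hne
        field_simp)
    funext i
    have h1 := congrArg (fun p => coeff p i.1) (congrFun hF i.2)
    simp only [finsetSum_coeff, coeff_C_mul_X_pow, Pi.zero_apply, coeff_zero] at h1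
    rw [Finset.sum_eq_single i.1] at h1
    · simpa using h1
    · intro k _ hk
      rw [if_neg]
      intro h; exact hk (Fin.ext h.symm)
    · simp)
  exact ⟨j, hj, det_choose_ne_zero (fun i' => (j i').1 * m + (j i').2)
    (fun l i' => (C₀ ^ ((j i').1 : ℕ) * θ ^ ((j i').2 : ℕ)) ^ (((l : ℕ) : ℤ) - 5)) hdet⟩

namespace BiquadraticUnits

/-- The interpolation determinant, cleared of denominators, lies in the order. -/
theorem det_mem_order {u v : ℤ} {α β : Bool → ℝ} (h : BiquadraticUnits u v α β)
    {ι : Type*} [Fintype ι] [DecidableEq ι] (n : Bool × Bool → ℝ) (hn : n ∈ h.order)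
    (hn0 : ∀ e, n e ≠ 0) (d : ℕ) (hd : d ≠ 0) (z : ι → ι → ℕ) (l : ι → ℤ) (A B : ι → ℤ)
    (r : ι → ℤ) (G : ℕ) (hG : ∀ π : Equiv.Perm ι, |∑ i, l i * r (π i)| ≤ G) :
    (fun e => n e ^ G * d ^ G * (Matrix.of fun i j =>
      (z i j : ℝ) * (α e.1 ^ A j * β e.2 ^ B j * (n e / d) ^ r j) ^ l i).det) ∈ h.order := by
  have hterm : ∀ π : Equiv.Perm ι,
      ((∏ i, (fun _ => (z i (π i) : ℝ)) * ((fun e => α e.1 ^ (A (π i) * l i))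
          * fun e => β e.2 ^ (B (π i) * l i)))
        * (n ^ (G + ∑ i, l i * r (π i)).toNat
          * (fun _ => (d : ℝ)) ^ (G - ∑ i, l i * r (π i)).toNat)) ∈ h.order := by
    intro π
    refine mul_mem (prod_mem fun i _ => mul_mem ?_ (mul_mem (h.zpow_left_mem _)
      (h.zpow_right_mem _))) (mul_mem (pow_mem hn _) (pow_mem ?_ _))
    · exact natCast_mem h.order _
    · exact natCast_mem h.order _
  have := sum_mem (t := Finset.univ) fun π _ =>
    zsmul_mem (hterm π) ((Equiv.Perm.sign π : ℤˣ) : ℤ)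
  convert this using 1
  funext e
  rw [← Matrix.det_transpose, Matrix.det_apply, Finset.mul_sum, Finset.sum_apply]
  refine Finset.sum_congr rfl fun π _ => ?_
  rw [Units.smul_def, mul_smul_comm]
  simp only [Pi.smul_apply, Pi.mul_apply, Pi.pow_apply, Finset.prod_apply]
  congr 1
  have hb := abs_le.mp (hG π)
  have e1 : n e ^ (G + ∑ i, l i * r (π i)).toNat = n e ^ G * n e ^ (∑ i, l i * r (π i)) := by
    rw [← zpow_natCast, Int.toNat_of_nonneg (by omega), zpow_add₀ (hn0 e), zpow_natCast]
  have hd' : (d : ℝ) ≠ 0 := Nat.cast_ne_zero.mpr hd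
  have e2 : (d : ℝ) ^ (G - ∑ i, l i * r (π i)).toNat
      = d ^ G * ((d : ℝ) ^ (∑ i, l i * r (π i)))⁻¹ := by
    rw [← zpow_natCast, Int.toNat_of_nonneg (by omega), zpow_sub₀ hd', zpow_natCast, div_eq_mul_inv]
  have e3 : ∏ i, (n e / d) ^ (r (π i) * l i)
      = n e ^ (∑ i, l i * r (π i)) * ((d : ℝ) ^ (∑ i, l i * r (π i)))⁻¹ := by
    rw [← inv_zpow, ← mul_zpow, ← div_eq_mul_inv]
    have hne : n e / d ≠ 0 := div_ne_zero (hn0 e) hd'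
    induction (Finset.univ : Finset ι) using Finset.induction_on with
    | empty => simp
    | insert a s ha ih =>
      rw [Finset.prod_insert ha, Finset.sum_insert ha, zpow_add₀ hne, ih, mul_comm (r _)]
  rw [e1, e2]
  simp only [Matrix.transpose_apply, Matrix.of_apply, mul_zpow, ← zpow_mul,
    Finset.prod_mul_distrib, e3]
  ring

end BiquadraticUnits

/-- Variance of the first coordinate over an injective selection from a grid. -/
theorem sum_sq_sub_le_grid {ι : Type*} [Fintype ι] {R S : ℕ} (j : ι → Fin R × Fin S)
    (hj : Function.Injective j) (f : Fin R × Fin S → ℝ) :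
    ∑ i, f (j i) ^ 2 ≤ ∑ g, f g ^ 2 := by
  classical
  rw [← Finset.sum_image (s := Finset.univ) (g := j) (f := fun g => f g ^ 2)
    (fun a _ b _ hab => hj hab)]
  exact Finset.sum_le_sum_of_subset_of_nonneg (Finset.subset_univ _) fun _ _ _ => sq_nonneg _

theorem sum_range_sq_sub_le (R : ℕ) :
    ∑ r ∈ Finset.range R, ((r : ℝ) - ((R : ℝ) - 1) / 2) ^ 2 ≤ (R : ℝ) ^ 3 / 12 := by
  have h : ∀ (c : ℝ) (n : ℕ), ∑ r ∈ Finset.range n, ((r : ℝ) - c) ^ 2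
      = n * (n - 1) * (2 * n - 1) / 6 - c * n * (n - 1) + n * c ^ 2 := by
    intro c n
    induction n with
    | zero => simp
    | succ n ih => rw [Finset.sum_range_succ, ih]; push_cast; ring
  rw [h]
  nlinarith [(Nat.cast_nonneg R : (0 : ℝ) ≤ R)]

theorem sum_grid_fst (R S : ℕ) :
    ∑ g : Fin R × Fin S, (((g.1 : ℕ) : ℝ) - ((R : ℝ) - 1) / 2) ^ 2
      ≤ (S : ℝ) * ((R : ℝ) ^ 3 / 12) := by
  rw [Fintype.sum_prod_type_right]
  simp only [Finset.sum_const, Finset.card_univ, Fintype.card_fin, nsmul_eq_mul]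
  have := sum_range_sq_sub_le R
  rw [Finset.sum_range] at this
  gcongr

theorem sum_grid_snd (R S : ℕ) :
    ∑ g : Fin R × Fin S, (((g.2 : ℕ) : ℝ) - ((S : ℝ) - 1) / 2) ^ 2
      ≤ (R : ℝ) * ((S : ℝ) ^ 3 / 12) := by
  rw [Fintype.sum_prod_type]
  simp only [Finset.sum_const, Finset.card_univ, Fintype.card_fin, nsmul_eq_mul]
  have := sum_range_sq_sub_le S
  rw [Finset.sum_range] at this
  gcongr

theorem sum_centered (P : ℕ) : ∑ i : Fin P × Fin 11, (((i.2 : ℕ) : ℝ) - 5) = 0 := by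
  rw [Fintype.sum_prod_type]
  have : ∑ l : Fin 11, (((l : ℕ) : ℝ) - 5) = 0 := by
    simp only [Fin.sum_univ_succ, Fin.sum_univ_zero]; simp; norm_num
  simp [this]

theorem sum_centered_sq (P : ℕ) :
    ∑ i : Fin P × Fin 11, (((i.2 : ℕ) : ℝ) - 5) ^ 2 = 110 * (P : ℝ) := by
  rw [Fintype.sum_prod_type]
  have : ∑ l : Fin 11, (((l : ℕ) : ℝ) - 5) ^ 2 = 110 := by
    simp only [Fin.sum_univ_succ, Fin.sum_univ_zero]; simp; norm_num
  simp only [this]; simp [mul_comm]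

/-- The determinant with exponents `l i * (ω * z j + r j * Λ)`, for a centred weight `l`. -/
theorem abs_det_chebyshev_exp_centered_le {ι : Type*} [Fintype ι] [DecidableEq ι] (N : ℕ)
    (hN : Fintype.card ι = N) (k : ι → ℕ) (x l z r : ι → ℝ) (hx : ∀ j, |x j| ≤ 1)
    (hl : ∑ i, l i = 0) (hl5 : ∀ i, |l i| ≤ 5) {c T ω Λ R ϱ : ℝ} (hz : ∀ j, z j = T * x j + c)
    (hr : ∀ j, |r j| ≤ R) (hϱ : 1 ≤ ϱ) (hΛ : 10 * R * |Λ| * ϱ ^ N ≤ 1)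
    (M : Matrix ι ι ℝ) (hM : ∀ i j, M i j = (Polynomial.Chebyshev.T ℝ (k i : ℕ)).eval (x j)
      * Real.exp (l i * (ω * z j + r j * Λ))) :
    |M.det| * ϱ ^ (∑ p ∈ Finset.range N, p)
      ≤ N.factorial * ∏ i, (10 * ϱ ^ k i * Real.exp (|l i * ω * T| * ((ϱ + ϱ⁻¹) / 2))) := by
  have hϱ0 : 0 < ϱ := by linarith
  have hrow : M = Matrix.of fun i j => Real.exp (l i * (ω * c)) * (Matrix.of fun i j =>
      (Polynomial.Chebyshev.T ℝ (k i : ℕ)).eval (x j) * Real.exp (l i * ω * T * x j)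
        * Real.exp (l i * (r j * Λ))) i j := by
    ext i j
    rw [hM]
    simp only [Matrix.of_apply]
    rw [show l i * (ω * z j + r j * Λ) = l i * (ω * c) + l i * ω * T * x j + l i * (r j * Λ) by
      rw [hz]; ring, Real.exp_add, Real.exp_add]
    ring
  rw [hrow, Matrix.det_mul_column, ← Real.exp_sum, ← Finset.sum_mul, hl, zero_mul,
    Real.exp_zero, one_mul]
  refine abs_det_chebyshev_exp_le N hN k x hx (fun i => l i * ω * T)
    (fun i j => l i * (r j * Λ)) ϱ hϱ ?_ _ fun _ _ => rfl
  intro i j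
  refine le_trans ?_ hΛ
  rw [abs_mul, abs_mul]
  have h1 := hl5 i
  have h2 := hr j
  calc _ ≤ 2 * (5 * (R * |Λ|)) * ϱ ^ N := by gcongr
    _ = _ := by ring

/-- Combination of the estimates at the four places with a lower bound for the norm. -/
theorem le_of_norm_bound (D E w A : Bool × Bool → ℝ) (hw : ∀ e, 0 < w e) {F Q Nf Bt : ℝ}
    (hQ : 0 < Q) (hNf : 0 ≤ Nf) (hBt : 0 ≤ Bt)
    (hnorm : 1 ≤ ∏ e, |w e * D e|) (hDE : ∀ e, |D e| ≤ F * |E e|)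
    (hE : ∀ e, |E e| ≤ Nf * Real.exp (A e)) (hEQ : |E (true, true)| * Q ≤ Nf * Bt) :
    Q ≤ (∏ e, w e) * F ^ 4 * Nf ^ 4
      * Real.exp (A (true, false) + A (false, true) + A (false, false)) * Bt := by
  have hall : ∀ e, |w e * D e| ≤ w e * (F * |E e|) := by
    intro e
    rw [abs_mul, abs_of_pos (hw e)]
    exact mul_le_mul_of_nonneg_left (hDE e) (hw e).le
  have hp : 0 ≤ ∏ e, w e := Finset.prod_nonneg fun e _ => (hw e).le
  calc Q = Q * 1 := (mul_one _).symm
    _ ≤ Q * ∏ e, |w e * D e| := by gcongr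
    _ ≤ Q * ∏ e, (w e * (F * |E e|)) := by
        gcongr with e _
        exact hall e
    _ = (∏ e, w e) * F ^ 4 * (|E (true, true)| * Q) * |E (true, false)|
        * |E (false, true)| * |E (false, false)| := by
        rw [Finset.prod_mul_distrib, Fintype.prod_prod_type (f := fun e => F * |E e|)]
        simp only [Fintype.prod_bool]
        ring
    _ ≤ (∏ e, w e) * F ^ 4 * (Nf * Bt) * (Nf * Real.exp (A (true, false)))
        * (Nf * Real.exp (A (false, true))) * (Nf * Real.exp (A (false, false))) := by
        gcongr
        · exact hE _
        · exact hE _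
        · exact hE _
    _ = _ := by
        rw [Real.exp_add, Real.exp_add]
        ring

theorem exp_mul_zpow_eq {x y w p q : ℝ} (hx : 0 < x) (hy : 0 < y) (hw : 0 < w) (ν r s : ℕ) (l : ℤ)
    (hp : p = ν * Real.log x + Real.log w) (hq : q = Real.log y - Real.log x) :
    (x ^ (ν * r - s : ℤ) * y ^ (s : ℤ) * w ^ (r : ℤ)) ^ l = Real.exp (l * (r * p + s * q)) := by
  rw [← Real.exp_log (x := (x ^ (ν * r - s : ℤ) * y ^ (s : ℤ) * w ^ (r : ℤ)) ^ l) (by positivity)]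
  congr 1
  rw [Real.log_zpow, Real.log_mul (by positivity) (by positivity),
    Real.log_mul (by positivity) (by positivity), Real.log_zpow, Real.log_zpow, Real.log_zpow,
    hp, hq]
  push_cast
  ring

theorem abs_sum_grid_fst_le {P R S : ℕ} (j : Fin P × Fin 11 → Fin R × Fin S)
    (hj : Function.Injective j) {Gr : ℝ} (hGr0 : 0 ≤ Gr)
    (hGr : 110 * P * (S * ((R : ℝ) ^ 3 / 12)) ≤ Gr ^ 2) (π : Equiv.Perm (Fin P × Fin 11)) :
    |∑ i, (((i.2 : ℕ) : ℝ) - 5) * (((j (π i)).1 : ℕ) : ℝ)| ≤ Gr := by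
  refine abs_sum_mul_perm_le (fun i : Fin P × Fin 11 => ((i.2 : ℕ) : ℝ) - 5)
    (fun i => (((j i).1 : ℕ) : ℝ)) (sum_centered P) π (((R : ℝ) - 1) / 2) hGr0 (le_trans ?_ hGr)
  rw [sum_centered_sq]
  gcongr
  exact (sum_sq_sub_le_grid j hj fun g => ((g.1 : ℕ) : ℝ) - ((R : ℝ) - 1) / 2).trans
    (sum_grid_fst R S)

theorem abs_sum_grid_snd_le {P R S : ℕ} (j : Fin P × Fin 11 → Fin R × Fin S)
    (hj : Function.Injective j) {Gs : ℝ} (hGs0 : 0 ≤ Gs)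
    (hGs : 110 * P * (R * ((S : ℝ) ^ 3 / 12)) ≤ Gs ^ 2) (π : Equiv.Perm (Fin P × Fin 11)) :
    |∑ i, (((i.2 : ℕ) : ℝ) - 5) * (((j (π i)).2 : ℕ) : ℝ)| ≤ Gs := by
  refine abs_sum_mul_perm_le (fun i : Fin P × Fin 11 => ((i.2 : ℕ) : ℝ) - 5)
    (fun i => (((j i).2 : ℕ) : ℝ)) (sum_centered P) π (((S : ℝ) - 1) / 2) hGs0 (le_trans ?_ hGs)
  rw [sum_centered_sq]
  gcongr
  exact (sum_sq_sub_le_grid j hj fun g => ((g.2 : ℕ) : ℝ) - ((S : ℝ) - 1) / 2).trans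
    (sum_grid_snd R S)

theorem abs_grid_rescaled_le {R S m : ℕ} (g : Fin R × Fin S) {T : ℝ} (hT : 0 < T)
    (hTe : T = (((R : ℝ) - 1) * m + ((S : ℝ) - 1)) / 2) :
    |(((g.1 : ℕ) * m + (g.2 : ℕ) : ℕ) - T) / T| ≤ 1 := by
  rw [abs_div, abs_of_pos hT, div_le_one hT, abs_le]
  have h1 : ((g.1 : ℕ) : ℝ) ≤ R - 1 := by
    rw [le_sub_iff_add_le]; exact_mod_cast g.1.2
  have h2 : ((g.2 : ℕ) : ℝ) ≤ S - 1 := by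
    rw [le_sub_iff_add_le]; exact_mod_cast g.2.2
  have h3 : ((g.1 : ℕ) : ℝ) * m ≤ (R - 1) * m := by gcongr
  have h4 : (0 : ℝ) ≤ (g.1 : ℕ) * m := by positivity
  have h5 : (0 : ℝ) ≤ (g.2 : ℕ) := by positivity
  push_cast
  constructor <;> linarith

namespace BiquadraticUnits

/-- The inequality obtained by comparing the two sides of the estimate for the norm of the
interpolation determinant. -/
theorem interpolation_inequality {u v : ℤ} {α β : Bool → ℝ} (h : BiquadraticUnits u v α β)
    (hα : ∀ i, 0 < α i) (hβ : ∀ i, 0 < β i) (n : Bool × Bool → ℝ) (hn : n ∈ h.order)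
    (hn0 : ∀ e, 0 < n e) (d : ℕ) (hd : 0 < d) (ν m P R S G : ℕ) (hR : 0 < R)
    (hSm : S ≤ m) (hS : 11 ≤ S) (hcount : 11 * (P - 1) < R * (S - 11 + 1))
    (hαβ : α true < β true) (Gr Gs : ℝ) (hGr0 : 0 ≤ Gr) (hGs0 : 0 ≤ Gs)
    (hGr : 110 * P * (S * ((R : ℝ) ^ 3 / 12)) ≤ Gr ^ 2)
    (hGs : 110 * P * (R * ((S : ℝ) ^ 3 / 12)) ≤ Gs ^ 2)
    (hG : Gr ≤ G) (a b : Bool × Bool → ℝ)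
    (ha : ∀ e, a e = ν * Real.log (α e.1) + Real.log (n e / d))
    (hb : ∀ e, b e = Real.log (β e.2) - Real.log (α e.1)) (ω Λ T ϱ : ℝ)
    (hω : b (true, true) = ω) (hΛ : a (true, true) = m * ω + Λ)
    (hT : T = (((R : ℝ) - 1) * m + ((S : ℝ) - 1)) / 2) (hϱ : 1 ≤ ϱ)
    (hsmall : 10 * R * |Λ| * ϱ ^ (11 * P) ≤ 1) :
    ϱ ^ (∑ p ∈ Finset.range (11 * P), p)
      ≤ (∏ e, (n e * d)) ^ G
        * ((∏ k : Fin P, (2 * (T / 2) ^ (k : ℕ) / (k : ℕ).factorial)) ^ 11) ^ 4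
        * ((11 * P).factorial : ℝ) ^ 4
        * Real.exp ((|a (true, false)| + |a (false, true)| + |a (false, false)|) * Gr
          + (|b (true, false)| + |b (false, true)| + |b (false, false)|) * Gs)
        * ∏ i : Fin P × Fin 11, (10 * ϱ ^ (i.1 : ℕ)
            * Real.exp (|(((i.2 : ℕ) : ℝ) - 5) * ω * T| * ((ϱ + ϱ⁻¹) / 2))) := by
  have hd' : (0 : ℝ) < d := Nat.cast_pos.mpr hd
  have hϱ0 : 0 < ϱ := by linarith
  have hα1 : 0 < α true := hα true
  have hT0 : 0 < T := by
    have h1 : (1 : ℝ) ≤ R := by exact_mod_cast hR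
    have h2 : (11 : ℝ) ≤ S := by exact_mod_cast hS
    have h3 : (0 : ℝ) ≤ m := by positivity
    rw [hT]
    nlinarith
  have hcard : Fintype.card (Fin P × Fin 11) = 11 * P := by simp [mul_comm]
  obtain ⟨j, hj, hdet⟩ := exists_grid_det_ne_zero P R S m
    (α true ^ ν * (n (true, true) / d)) (β true / α true)
    (by have := hn0 (true, true); positivity) ((one_lt_div hα1).mpr hαβ) hSm hS hcount
  have hη : ∀ e (i' : Fin P × Fin 11) (l : Fin 11), _ := fun e i' l =>
    exp_mul_zpow_eq (hα e.1) (hβ e.2) (div_pos (hn0 e) hd') ν (j i').1 (j i').2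
      (((l : ℕ) : ℤ) - 5) (ha e) (hb e)
  have hmem := h.det_mem_order (ι := Fin P × Fin 11) n hn (fun e => (hn0 e).ne') d hd.ne'
    (fun i i' => ((j i').1 * m + (j i').2 : ℕ).choose i.1) (fun i => ((i.2 : ℕ) : ℤ) - 5)
    (fun i' => ν * ((j i').1 : ℕ) - ((j i').2 : ℕ)) (fun i' => ((j i').2 : ℕ))
    (fun i' => ((j i').1 : ℕ)) G (by
      intro π
      have := (abs_sum_grid_fst_le j hj hGr0 hGr π).trans hG
      exact_mod_cast this)
  simp only [hη] at hmem
  have hnorm := h.one_le_prod_abs hmem (true, true) (by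
    refine mul_ne_zero (mul_ne_zero (pow_ne_zero _ (hn0 _).ne') (pow_ne_zero _ hd'.ne'))
      (ne_of_eq_of_ne ?_ hdet)
    refine congrArg Matrix.det (Matrix.ext fun i i' => ?_)
    rw [Matrix.of_apply, Matrix.of_apply, ← hη]
    refine congrArg₂ _ rfl (congrArg (· ^ _) ?_)
    rw [zpow_sub₀ hα1.ne', zpow_natCast, zpow_natCast, zpow_natCast, zpow_mul, zpow_natCast,
      zpow_natCast, mul_pow, div_pow]
    ring)
  have hx1 : ∀ i', _ := fun i' => abs_grid_rescaled_le (j i') hT0 hT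
  have hprod : ∏ e, (n e ^ G * (d : ℝ) ^ G) = (∏ e, (n e * d)) ^ G := by
    rw [← Finset.prod_pow]
    exact Finset.prod_congr rfl fun e _ => (mul_pow _ _ _).symm
  rw [← hprod]
  have key := le_of_norm_bound _ (fun e => (Matrix.of fun (i i' : Fin P × Fin 11) =>
      (Polynomial.Chebyshev.T ℝ ((i.1 : ℕ) : ℤ)).eval
          ((((j i').1 * m + (j i').2 : ℕ) - T) / T)
        * Real.exp (((((i.2 : ℕ) : ℤ) - 5 : ℤ) : ℝ)
          * (((j i').1 : ℕ) * a e + ((j i').2 : ℕ) * b e))).det)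
    (fun e => n e ^ G * (d : ℝ) ^ G) (fun e => |a e| * Gr + |b e| * Gs)
    (fun e => mul_pos (pow_pos (hn0 e) _) (pow_pos hd' _))
    (F := (∏ k : Fin P, (2 * (T / 2) ^ (k : ℕ) / (k : ℕ).factorial)) ^ 11)
    (Q := ϱ ^ (∑ p ∈ Finset.range (11 * P), p)) (Nf := ((11 * P).factorial : ℝ))
    (Bt := ∏ i : Fin P × Fin 11, (10 * ϱ ^ (i.1 : ℕ)
            * Real.exp (|(((i.2 : ℕ) : ℝ) - 5) * ω * T| * ((ϱ + ϱ⁻¹) / 2))))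
    (by positivity) (by positivity) (by positivity) hnorm
    (fun e => abs_det_choose_le_chebyshev (fun i' => (j i').1 * m + (j i').2) T T hT0
      fun l i' => Real.exp (((((l : ℕ) : ℤ) - 5 : ℤ) : ℝ)
        * (((j i').1 : ℕ) * a e + ((j i').2 : ℕ) * b e)))
    (fun e => by
      rw [← hcard]
      refine abs_det_exp_le (fun i i' => (Polynomial.Chebyshev.T ℝ ((i.1 : ℕ) : ℤ)).eval
          ((((j i').1 * m + (j i').2 : ℕ) - T) / T))
        (fun i i' => Polynomial.Chebyshev.abs_eval_T_real_le_one _ (hx1 i'))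
        (fun i => ((i.2 : ℕ) : ℝ) - 5) (fun i' => ((j i').1 : ℕ)) (fun i' => ((j i').2 : ℕ))
        (a e) (b e) Gr Gs (abs_sum_grid_fst_le j hj hGr0 hGr) (abs_sum_grid_snd_le j hj hGs0 hGs)
        _ fun i i' => ?_
      push_cast
      rfl)
    (by
      refine abs_det_chebyshev_exp_centered_le (11 * P) hcard (fun i => i.1)
        (fun i' => (((j i').1 * m + (j i').2 : ℕ) - T) / T) (fun i => ((i.2 : ℕ) : ℝ) - 5)
        (fun i' => ((j i').1 * m + (j i').2 : ℕ)) (fun i' => ((j i').1 : ℕ)) hx1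
        (sum_centered P) (fun i => ?_) (c := T) (T := T) (fun i' => ?_) (R := R) (fun i' => ?_) hϱ
        hsmall _ fun i i' => ?_
      · have h1 : ((i.2 : ℕ) : ℝ) ≤ 10 := by exact_mod_cast Nat.lt_succ_iff.mp i.2.2
        have h2 : (0 : ℝ) ≤ ((i.2 : ℕ) : ℝ) := by positivity
        rw [abs_le]; constructor <;> linarith
      · field_simp
        ring
      · rw [Nat.abs_cast]
        exact_mod_cast (j i').1.2.le
      · rw [Matrix.of_apply, hω, hΛ]
        push_cast
        congr 2
        ring)
  refine key.trans (le_of_eq ?_)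
  congr 3
  ring

end BiquadraticUnits

theorem mul_log_sub_le_log_factorial (n : ℕ) :
    (n : ℝ) * Real.log n - n ≤ Real.log n.factorial := by
  rcases n.eq_zero_or_pos with rfl | hn
  · simp
  have hn' : (0 : ℝ) < n := by exact_mod_cast hn
  have h := Real.pow_div_factorial_le_exp (n : ℝ) hn'.le n
  have h2 := Real.log_le_log (by positivity) h
  rw [Real.log_exp, Real.log_div (by positivity) (by positivity), Real.log_pow] at h2
  linarith

theorem le_sum_log_factorial (Q : ℕ) :
    (Q : ℝ) ^ 2 / 2 * Real.log Q - 3 / 4 * (Q : ℝ) ^ 2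
      ≤ ∑ k ∈ Finset.range (Q + 1), Real.log k.factorial := by
  induction Q with
  | zero => simp
  | succ Q ih =>
    rw [Finset.sum_range_succ]
    rcases Q.eq_zero_or_pos with rfl | hQ
    · norm_num
    have hQ' : (1 : ℝ) ≤ Q := by exact_mod_cast hQ
    have h1 := mul_log_sub_le_log_factorial (Q + 1)
    have h2 : Real.log ((Q + 1 : ℕ) : ℝ) ≤ Real.log Q + 1 / Q := by
      have := Real.log_le_sub_one_of_pos (x := (Q + 1 : ℝ) / Q) (by positivity)
      rw [Real.log_div (by positivity) (by positivity)] at this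
      push_cast
      have e : ((Q : ℝ) + 1) / Q - 1 = 1 / Q := by field_simp; ring
      linarith
    have h3 : (1 : ℝ) / 2 ≤ Real.log ((Q + 1 : ℕ) : ℝ) := by
      have : Real.log 2 ≤ Real.log ((Q + 1 : ℕ) : ℝ) :=
        Real.log_le_log (by norm_num) (by push_cast; linarith)
      linarith [Real.log_two_gt_d9]
    have h4 : (Q : ℝ) ^ 2 / 2 * Real.log ((Q + 1 : ℕ) : ℝ)
        ≤ (Q : ℝ) ^ 2 / 2 * Real.log Q + Q / 2 := by
      have := mul_le_mul_of_nonneg_left h2 (by positivity : (0 : ℝ) ≤ (Q : ℝ) ^ 2 / 2)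
      have e : (Q : ℝ) ^ 2 / 2 * (Real.log Q + 1 / Q)
        = (Q : ℝ) ^ 2 / 2 * Real.log Q + Q / 2 := by field_simp
      linarith
    generalize Real.log ((Q + 1 : ℕ) : ℝ) = y at *
    push_cast at *
    nlinarith

theorem log_factorial_le (n : ℕ) : Real.log n.factorial ≤ n * Real.log n := by
  rw [← Real.log_pow]
  exact Real.log_le_log (by positivity) (by exact_mod_cast Nat.factorial_le_pow n)

theorem sum_abs_centered (P : ℕ) :
    ∑ i : Fin P × Fin 11, |((i.2 : ℕ) : ℝ) - 5| = 30 * (P : ℝ) := by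
  rw [Fintype.sum_prod_type]
  have : ∑ l : Fin 11, |((l : ℕ) : ℝ) - 5| = 30 := by
    simp only [Fin.sum_univ_succ, Fin.sum_univ_zero]; simp; norm_num [abs_of_pos, abs_of_neg]
  simp only [this]; simp [mul_comm]

theorem sum_range_cast (n : ℕ) : ∑ p ∈ Finset.range n, (p : ℝ) = n * (n - 1) / 2 := by
  induction n with
  | zero => simp
  | succ n ih => rw [Finset.sum_range_succ, ih]; push_cast; ring

theorem sum_grid_degree (P : ℕ) :
    ∑ i : Fin P × Fin 11, ((i.1 : ℕ) : ℝ) = 11 * (P * (P - 1) / 2) := by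
  rw [Fintype.sum_prod_type_right, ← sum_range_cast, Finset.sum_range]
  simp

/-- Upper bound for the logarithm of the change of basis factor. -/
theorem sum_log_chebyshev_factor_le (Q : ℕ) (hQ : 0 < Q) {T : ℝ} (hT : 2 ≤ T) :
    ∑ k : Fin (Q + 1), Real.log (2 * (T / 2) ^ (k : ℕ) / (k : ℕ).factorial)
      ≤ (Q + 1) * Real.log 2 + (Q : ℝ) ^ 2 / 2 * (Real.log (T / 2 / Q) + 3 / 2)
        + Q / 2 * Real.log (T / 2) := by
  have hT0 : 0 < T / 2 := by linarith
  have hQ' : (0 : ℝ) < Q := by exact_mod_cast hQ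
  rw [Finset.sum_congr rfl fun (k : Fin (Q + 1)) _ => show
    Real.log (2 * (T / 2) ^ (k : ℕ) / (k : ℕ).factorial)
      = Real.log 2 + (k : ℕ) * Real.log (T / 2) - Real.log (k : ℕ).factorial by
    rw [Real.log_div (by positivity) (by positivity), Real.log_mul (by positivity) (by positivity),
      Real.log_pow], ← Finset.sum_range fun k : ℕ =>
      Real.log 2 + (k : ℝ) * Real.log (T / 2) - Real.log k.factorial, Finset.sum_sub_distrib,
      Finset.sum_add_distrib, ← Finset.sum_mul, sum_range_cast, Finset.sum_const,
      Finset.card_range, nsmul_eq_mul, Real.log_div hT0.ne' hQ'.ne']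
  have := le_sum_log_factorial Q
  push_cast
  nlinarith

/-- The logarithmic form of the interpolation inequality. -/
theorem log_interpolation_inequality {P G : ℕ} {T ϱ ω W E Nf : ℝ} {h lam W' : ℝ}
    (hW : 0 < W) (hWl : Real.log W ≤ W') (hT : 0 < T) (hω : 0 < ω)
    (hlam : Real.log ϱ = lam) (hϱ : 1 ≤ ϱ) (hh : (ϱ + ϱ⁻¹) / 2 ≤ h) (hNf : 0 < Nf)
    (H : ϱ ^ (∑ p ∈ Finset.range (11 * P), p)
      ≤ W ^ G
        * ((∏ k : Fin P, (2 * (T / 2) ^ (k : ℕ) / (k : ℕ).factorial)) ^ 11) ^ 4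
        * Nf ^ 4 * Real.exp E
        * ∏ i : Fin P × Fin 11, (10 * ϱ ^ (i.1 : ℕ)
            * Real.exp (|(((i.2 : ℕ) : ℝ) - 5) * ω * T| * ((ϱ + ϱ⁻¹) / 2)))) :
    lam * (11 * P * (11 * P - 1) / 2) ≤ G * W'
      + 44 * ∑ k : Fin P, Real.log (2 * (T / 2) ^ (k : ℕ) / (k : ℕ).factorial)
      + 4 * Real.log Nf + E + (11 * P * Real.log 10 + lam * (11 * (P * (P - 1) / 2))
        + 30 * P * (ω * T * h)) := by
  have hϱ0 : 0 < ϱ := by linarith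
  have hk : ∀ k : Fin P, 0 < 2 * (T / 2) ^ (k : ℕ) / (k : ℕ).factorial := fun k => by positivity
  have hF : 0 < ∏ k : Fin P, (2 * (T / 2) ^ (k : ℕ) / (k : ℕ).factorial) :=
    Finset.prod_pos fun k _ => hk k
  have hB : 0 < ∏ i : Fin P × Fin 11, (10 * ϱ ^ (i.1 : ℕ)
            * Real.exp (|(((i.2 : ℕ) : ℝ) - 5) * ω * T| * ((ϱ + ϱ⁻¹) / 2))) := by positivity
  have H := Real.log_le_log (by positivity) H
  rw [Real.log_mul (by positivity) hB.ne', Real.log_mul (by positivity) (by positivity),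
    Real.log_mul (by positivity) (by positivity), Real.log_mul (by positivity) (by positivity),
    Real.log_exp, Real.log_pow, Real.log_pow, Real.log_pow, Real.log_pow, Real.log_pow,
    Real.log_prod (fun k _ => (hk k).ne'), Real.log_prod (fun k _ => by positivity), hlam] at H
  have e1 : ∑ i : Fin P × Fin 11, Real.log (10 * ϱ ^ (i.1 : ℕ)
      * Real.exp (|(((i.2 : ℕ) : ℝ) - 5) * ω * T| * ((ϱ + ϱ⁻¹) / 2)))
      = 11 * P * Real.log 10 + lam * (11 * (P * (P - 1) / 2))
        + 30 * P * (ω * T * ((ϱ + ϱ⁻¹) / 2)) := by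
    rw [Finset.sum_congr rfl fun (i : Fin P × Fin 11) _ => show Real.log (10 * ϱ ^ (i.1 : ℕ)
      * Real.exp (|(((i.2 : ℕ) : ℝ) - 5) * ω * T| * ((ϱ + ϱ⁻¹) / 2)))
      = Real.log 10 + (i.1 : ℕ) * lam
        + |((i.2 : ℕ) : ℝ) - 5| * (ω * T * ((ϱ + ϱ⁻¹) / 2)) by
      rw [Real.log_mul (by positivity) (by positivity), Real.log_mul (by positivity)
        (by positivity), Real.log_exp, Real.log_pow, abs_mul, abs_mul, abs_of_pos hω,
        abs_of_pos hT, hlam]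
      ring, Finset.sum_add_distrib, Finset.sum_add_distrib, ← Finset.sum_mul, ← Finset.sum_mul,
      sum_abs_centered, sum_grid_degree]
    simp only [Finset.sum_const, Finset.card_univ, Fintype.card_fin, Fintype.card_prod,
      nsmul_eq_mul]
    push_cast
    ring
  rw [e1, Nat.cast_sum, sum_range_cast] at H
  push_cast at H
  have h1 : (G : ℝ) * Real.log W ≤ G * W' := by gcongr
  have h2 : 30 * P * (ω * T * ((ϱ + ϱ⁻¹) / 2)) ≤ 30 * P * (ω * T * h) := by gcongr
  linarith

theorem exp_interpolation_radius_le : Real.exp (23 / 5) ≤ 99.9 := by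
  have h : Real.exp (23 / 5) ^ 5 ≤ (99.9 : ℝ) ^ 5 := by
    rw [← Real.exp_nat_mul]
    have e : ((5 : ℕ) : ℝ) * (23 / 5) = (23 : ℕ) * 1 := by norm_num
    rw [e, Real.exp_nat_mul]
    calc _ ≤ (2.7182818286 : ℝ) ^ 23 :=
          pow_le_pow_left₀ (Real.exp_pos _).le Real.exp_one_lt_d9.le _
      _ ≤ _ := by norm_num
  exact le_of_pow_le_pow_left₀ (by norm_num) (by norm_num) h

theorem log_ratio_bound : Real.log 39.5 ≤ 3.7 := by
  rw [Real.log_le_iff_le_exp (by norm_num)]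
  have h : (39.5 : ℝ) ^ 10 ≤ Real.exp 3.7 ^ 10 := by
    rw [← Real.exp_nat_mul]
    have e : ((10 : ℕ) : ℝ) * 3.7 = (37 : ℕ) * 1 := by norm_num
    rw [e, Real.exp_nat_mul]
    calc (39.5 : ℝ) ^ 10 ≤ (2.7182818283 : ℝ) ^ 37 := by norm_num
      _ ≤ _ := pow_le_pow_left₀ (by norm_num) Real.exp_one_gt_d9.le _
  exact le_of_pow_le_pow_left₀ (by norm_num) (Real.exp_pos _).le h

theorem log_le_small_mul {N : ℝ} (hN : 145000 ≤ N) : Real.log N ≤ N / 10000 := by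
  have h1 := Real.log_le_sub_one_of_pos (x := N / Real.exp 12) (by positivity)
  rw [Real.log_div (by positivity) (by positivity), Real.log_exp] at h1
  have h2 : (160000 : ℝ) ≤ Real.exp 12 := by
    have e : (12 : ℝ) = (12 : ℕ) * 1 := by norm_num
    rw [e, Real.exp_nat_mul]
    calc (160000 : ℝ) ≤ (2.7182818283 : ℝ) ^ 12 := by norm_num
      _ ≤ _ := pow_le_pow_left₀ (by norm_num) Real.exp_one_gt_d9.le _
  have h3 : N / Real.exp 12 ≤ N / 160000 := by gcongr
  linarith

set_option maxHeartbeats 1000000 in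
/-- The logarithmic inequality is contradictory for the chosen parameters. -/
theorem false_of_log_inequality {N R S m X ν T ω P Q G Gr Gs E lf lc : ℝ}
    (hX : 7.9 ≤ X) (hν : 2 ≤ ν) (hm : 2790 * ν * X ≤ m) (hR : 6 * X ≤ R)
    (hS : S ≤ 0.07 * m) (hN1 : 0.06975 * (R * m) ≤ N)
    (hP : N = 11 * P) (hQ : Q = P - 1) (hT0 : 2 ≤ T) (hT : T ≤ R * m / 2)
    (hωT : ω * T ≤ R * (ν * X + 0.011) / 2) (hGr : Gr = 0.9146 * N * R) (hGs : Gs = 0.9146 * N * S)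
    (hG : G ≤ Gr + 1)
    (hE : E ≤ (3 * ν * X + 0.03) * Gr + (4 * X + 0.01) * Gs) (hlf : lf ≤ N * Real.log N)
    (hlc : lc ≤ P * Real.log 2 + Q ^ 2 / 2 * (Real.log (T / 2 / Q) + 3 / 2)
        + Q / 2 * Real.log (T / 2))
    (H : 23 / 5 * (N * (N - 1) / 2) ≤ G * (32 * X + 0.08) + 44 * lc
      + 4 * lf + E + (N * Real.log 10 + 23 / 5 * (11 * (P * (P - 1) / 2))
        + 30 * P * (ω * T * 50))) : False := by
  have hνX : 15.8 ≤ ν * X := by nlinarith only [hX, hν]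
  have hm0 : 44082 ≤ m := by linarith
  have hR0 : 47.4 ≤ R := by linarith
  have hXm : 5580 * X ≤ m := by nlinarith only [hX, hν, hm]
  have hM : 2089000 ≤ R * m := by nlinarith only [hm0, hR0]
  have hN0 : 145000 ≤ N := by linarith
  have hRm : 0.06975 * (N * R * m) ≤ N ^ 2 := by
    have := mul_le_mul_of_nonneg_left hN1 (by linarith : 0 ≤ N)
    linarith
  have hNR0 : 0 ≤ N * R := by positivity
  have hNRX : N * R * X ≤ 0.00257 * N ^ 2 := by
    have := mul_le_mul_of_nonneg_left hXm hNR0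
    linarith [sq_nonneg N]
  have hNRνX : N * R * (ν * X) ≤ 0.00514 * N ^ 2 := by
    have h1 : 2790 * (ν * X) ≤ m := by linarith
    have := mul_le_mul_of_nonneg_left h1 hNR0
    linarith [sq_nonneg N]
  have hNR : N * R * 7.9 ≤ N * R * X := mul_le_mul_of_nonneg_left hX hNR0
  have hX1 : 1000 * X ≤ N * R * X := by
    have : 1000 ≤ N * R := by nlinarith only [hN0, hR0]
    nlinarith only [this, hX]
  have hN2 : 145000 * N ≤ N ^ 2 := by
    have := mul_le_mul_of_nonneg_left hN0 (by linarith : 0 ≤ N)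
    linarith
  have hNS : N * S * X ≤ 0.16727 * N ^ 2 := by
    have h1 : N * S * X ≤ N * (0.07 * m) * X := by gcongr
    have h2 : N * m * (6 * X) ≤ N * m * R := mul_le_mul_of_nonneg_left hR (by positivity)
    linarith
  have hNS' : N * S ≤ 0.03 * N ^ 2 := by
    rcases le_total S 0 with h | h
    · nlinarith only [h, hN0]
    · have h0 : 0 ≤ N * S := by positivity
      have := mul_le_mul_of_nonneg_left hX h0
      nlinarith only [this, hNS, sq_nonneg N]
  have b1 : G * (32 * X + 0.08) ≤ 0.077 * N ^ 2 := by
    have : G * (32 * X + 0.08) ≤ (0.9146 * N * R + 1) * (32 * X + 0.08) := by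
      rw [← hGr]; gcongr
    linarith
  have b2 : E ≤ 0.63 * N ^ 2 := by
    rw [hGr, hGs] at hE
    linarith
  have hlog := log_le_small_mul hN0
  have hlogN : N * Real.log N ≤ N ^ 2 / 10000 := by nlinarith only [hlog, hN0]
  have hQM : 0.0697 * (R * m) ≤ 11 * Q := by linarith
  have hQ0 : 0 < Q := by linarith
  have hQN : 11 * Q ≤ N := by linarith
  have c1 : Real.log (T / 2 / Q) ≤ 3.7 := by
    refine (Real.log_le_log (by positivity) ?_).trans log_ratio_bound
    rw [div_div, div_le_iff₀ (by positivity)]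
    linarith
  have c2 : Real.log (T / 2) ≤ N / 10000 + 2 := by
    have h1 : Real.log (T / 2) ≤ Real.log (4 * N) := Real.log_le_log (by positivity) (by linarith)
    rw [Real.log_mul (by norm_num) (by positivity)] at h1
    have h2 : Real.log 4 = 2 * Real.log 2 := by
      rw [show (4 : ℝ) = 2 ^ 2 by norm_num, Real.log_pow]; norm_num
    linarith [Real.log_two_lt_d9]
  have hl2 := Real.log_two_lt_d9
  have b3 : 44 * lc ≤ 0.9456 * N ^ 2 + 0.001 * N ^ 2 := by
    have d1 : P * Real.log 2 ≤ P * 0.7 := mul_le_mul_of_nonneg_left (by linarith) (by linarith)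
    have d2 : Q ^ 2 / 2 * (Real.log (T / 2 / Q) + 3 / 2) ≤ Q ^ 2 / 2 * 5.2 :=
      mul_le_mul_of_nonneg_left (by linarith) (by positivity)
    have d3 : Q / 2 * Real.log (T / 2) ≤ Q / 2 * (N / 10000 + 2) :=
      mul_le_mul_of_nonneg_left c2 (by positivity)
    have d4 : 121 * Q ^ 2 ≤ N ^ 2 := by nlinarith only [hQ0, hQN]
    have d5 : 11 * Q * (N / 10000 + 2) ≤ N * (N / 10000 + 2) := by gcongr
    linarith
  have hl10 : Real.log 10 ≤ 3 := by
    rw [Real.log_le_iff_le_exp (by norm_num)]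
    have e : (3 : ℝ) = (3 : ℕ) * 1 := by norm_num
    rw [e, Real.exp_nat_mul]
    calc (10 : ℝ) ≤ (2.7182818283 : ℝ) ^ 3 := by norm_num
      _ ≤ _ := pow_le_pow_left₀ (by norm_num) Real.exp_one_gt_d9.le _
  have b4 : N * Real.log 10 ≤ N * 3 := by gcongr
  have b5 : 23 / 5 * (11 * (P * (P - 1) / 2)) ≤ 0.2092 * N ^ 2 := by
    have : P = N / 11 := by linarith
    rw [this]
    linarith
  have b6 : 30 * P * (ω * T * 50) ≤ 0.352 * N ^ 2 := by
    have : 30 * P * (ω * T * 50) ≤ 30 * P * (R * (ν * X + 0.011) / 2 * 50) := by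
      have : 0 ≤ P := by linarith
      gcongr
    have e : P = N / 11 := by linarith
    rw [e] at this
    rw [e]
    linarith
  linarith

theorem mul_abs_mul_exp_pow_le_one {Λ X m R : ℝ} {N : ℕ} (hX : 7.9 ≤ X) (hm : 44082 ≤ m)
    (hR0 : 0 ≤ R)
    (hR : R ≤ 6 * X + 1) (hN : (N : ℝ) ≤ 0.07 * (R * m))
    (hΛ : |Λ| ≤ 4 * Real.exp (-(2 * m * X))) :
    10 * R * |Λ| * Real.exp (23 / 5) ^ N ≤ 1 := by
  have h1 : 40 * R ≤ Real.exp (40 * R) := by linarith [Real.add_one_le_exp (40 * R)]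
  calc 10 * R * |Λ| * Real.exp (23 / 5) ^ N
      ≤ 10 * R * (4 * Real.exp (-(2 * m * X))) * Real.exp (23 / 5) ^ N := by gcongr
    _ = 40 * R * (Real.exp (-(2 * m * X)) * Real.exp (23 / 5) ^ N) := by ring
    _ ≤ Real.exp (40 * R) * (Real.exp (-(2 * m * X)) * Real.exp (23 / 5) ^ N) := by gcongr
    _ = Real.exp (40 * R + (-(2 * m * X) + N * (23 / 5))) := by
        rw [← Real.exp_nat_mul, Real.exp_add, Real.exp_add]
    _ ≤ 1 := by
        rw [Real.exp_le_one_iff]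
        have h2 : R * m ≤ (6 * X + 1) * m := by gcongr
        have h3 : 7.9 * m ≤ X * m := by gcongr
        have h4 : 44082 * X ≤ m * X := by gcongr
        linarith

namespace BiquadraticUnits

set_option maxHeartbeats 1000000 in
/-- Two multiplicatively close units of the specified shape cannot exist. -/
theorem false_of_linear_form_small {u v : ℤ} {α β : Bool → ℝ} (h : BiquadraticUnits u v α β)
    (hα : ∀ i, 0 < α i) (hβ : ∀ i, 0 < β i) (n : Bool × Bool → ℝ) (hn : n ∈ h.order)
    (hn0 : ∀ e, 0 < n e) (d : ℕ) (hd : 0 < d) (ν m : ℕ) {X ω Λ : ℝ}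
    (hXα : Real.log (α true) = X) (hX : 7.9 ≤ X) (hω : Real.log (β true) = X + ω) (hω0 : 0 < ω)
    (hω1 : ω ≤ 0.003) (hχ : ∀ e, |Real.log (n e / d)| ≤ 0.01)
    (hW : ∀ e, Real.log (n e * d) ≤ 8 * X + 0.02) (hν : 2 ≤ ν) (hm : 2790 * ν * X ≤ m)
    (hΛ : ν * X + Real.log (n (true, true) / d) = m * ω + Λ)
    (hΛ1 : |Λ| ≤ 4 * Real.exp (-(2 * m * X))) : False := by
  have hd' : (0 : ℝ) < d := by exact_mod_cast hd
  have hν' : (2 : ℝ) ≤ ν := by exact_mod_cast hν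
  have hνX : 15.8 ≤ ν * X := by nlinarith only [hX, hν']
  have hm0 : (44082 : ℝ) ≤ m := by linarith
  have hα0 : Real.log (α false) = -X := by
    rw [← hXα, ← Real.log_inv, inv_eq_of_mul_eq_one_right h.mul_left]
  have hβ0 : Real.log (β false) = -(X + ω) := by
    rw [← hω, ← Real.log_inv, inv_eq_of_mul_eq_one_right h.mul_right]
  obtain ⟨R, hRdef⟩ : ∃ R : ℕ, R = ⌈6 * X⌉₊ := ⟨_, rfl⟩
  have hR1 : 6 * X ≤ R := by rw [hRdef]; exact Nat.le_ceil _
  have hR2 : (R : ℝ) ≤ 6 * X + 1 := by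
    rw [hRdef]; exact (Nat.ceil_lt_add_one (by linarith)).le
  have hR3 : 47 < R := by
    have : (47 : ℝ) < R := by linarith
    exact_mod_cast this
  have hm1 : 44082 ≤ m := by exact_mod_cast hm0
  obtain ⟨S, hSdef⟩ : ∃ S : ℕ, S = 7 * m / 100 := ⟨_, rfl⟩
  have hS1 : (S : ℝ) ≤ 0.07 * m := by
    have : 100 * S ≤ 7 * m := by omega
    have : (100 : ℝ) * S ≤ 7 * m := by exact_mod_cast this
    linarith
  have hS2 : 0.07 * (m : ℝ) ≤ S + 1 := by
    have : 7 * m ≤ 100 * (S + 1) := by omega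
    have : (7 : ℝ) * m ≤ 100 * (S + 1) := by exact_mod_cast this
    linarith
  obtain ⟨P, hPdef⟩ : ∃ P : ℕ, P = (R * (S - 10) - 1) / 11 + 1 := ⟨_, rfl⟩
  have hS3 : 1000 ≤ S := by omega
  have hM0 : 1 ≤ R * (S - 10) := Nat.mul_pos (by omega) (by omega)
  have hcast : ((R * (S - 10) : ℕ) : ℝ) = R * (S - 10) := by
    rw [Nat.cast_mul, Nat.cast_sub (by omega)]; norm_num
  have hP1 : (R : ℝ) * (S - 10) ≤ 11 * P := by
    rw [← hcast]
    have : R * (S - 10) ≤ 11 * P := by omega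
    exact_mod_cast this
  have hP2 : 11 * (P : ℝ) ≤ R * (S - 10) + 10 := by
    rw [← hcast]
    have : 11 * P ≤ R * (S - 10) + 10 := by omega
    exact_mod_cast this
  have hcount : 11 * (P - 1) < R * (S - 11 + 1) := by
    rw [show S - 11 + 1 = S - 10 by omega]
    omega
  have hR4 : (47 : ℝ) ≤ R := by exact_mod_cast hR3.le
  have hN1 : 0.06975 * ((R : ℝ) * m) ≤ 11 * P := by nlinarith only [hP1, hS2, hm0, hR4]
  have hN2 : 11 * (P : ℝ) ≤ 0.07 * (R * m) := by nlinarith only [hP2, hS1, hR4]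
  have hN0 : (0 : ℝ) ≤ 11 * P := by positivity
  obtain ⟨Gr, hGr⟩ : ∃ G : ℝ, G = 0.9146 * (11 * P) * R := ⟨_, rfl⟩
  obtain ⟨Gs, hGs⟩ : ∃ G : ℝ, G = 0.9146 * (11 * P) * S := ⟨_, rfl⟩
  have hGr0 : 0 ≤ Gr := by rw [hGr]; positivity
  have hGs0 : 0 ≤ Gs := by rw [hGs]; positivity
  have hSR : 10 / 12 * ((S : ℝ) * R) ≤ 0.9146 ^ 2 * (11 * P) := by
    have : (R : ℝ) * S ≤ R * (0.07 * m) := by gcongr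
    linarith
  have hGr2 : 110 * P * (S * ((R : ℝ) ^ 3 / 12)) ≤ Gr ^ 2 := by
    have := mul_le_mul_of_nonneg_left hSR (by positivity : (0 : ℝ) ≤ 11 * P * R ^ 2)
    rw [hGr]
    linarith
  have hGs2 : 110 * P * (R * ((S : ℝ) ^ 3 / 12)) ≤ Gs ^ 2 := by
    have := mul_le_mul_of_nonneg_left hSR (by positivity : (0 : ℝ) ≤ 11 * P * S ^ 2)
    rw [hGs]
    linarith
  obtain ⟨T, hT⟩ : ∃ T : ℝ, T = (((R : ℝ) - 1) * m + ((S : ℝ) - 1)) / 2 := ⟨_, rfl⟩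
  have hT1 : T ≤ R * m / 2 := by rw [hT]; linarith
  have hT2 : 2 ≤ T := by
    rw [hT]
    have : (0 : ℝ) ≤ S := by positivity
    nlinarith only [hm0, hR4, this]
  have hαβ : α true < β true := by
    rw [← Real.log_lt_log_iff (hα _) (hβ _), hXα, hω]
    linarith
  have hsmall := mul_abs_mul_exp_pow_le_one (N := 11 * P) hX hm0 (Nat.cast_nonneg R) hR2
    (by push_cast; exact hN2) hΛ1
  have hϱ : 1 ≤ Real.exp (23 / 5) := Real.one_le_exp (by norm_num)
  have H := h.interpolation_inequality hα hβ n hn hn0 d hd ν m P R S ⌈Gr⌉₊ (by omega) (by omega)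
    (by omega) hcount hαβ Gr Gs hGr0 hGs0 hGr2 hGs2 (Nat.le_ceil _) _ _ (fun _ => rfl)
    (fun _ => rfl) ω Λ T (Real.exp (23 / 5)) (by rw [hω, hXα]; ring) (by rw [hXα, hΛ]) hT hϱ hsmall
  have hWpos : ∀ e, 0 < n e * d := fun e => mul_pos (hn0 e) hd'
  have hlogW : Real.log (∏ e, (n e * d)) ≤ 32 * X + 0.08 := by
    rw [Real.log_prod fun e _ => (hWpos e).ne']
    refine (Finset.sum_le_card_nsmul _ _ _ fun e _ => hW e).trans (le_of_eq ?_)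
    simp
    ring
  have hrad : (Real.exp (23 / 5) + (Real.exp (23 / 5))⁻¹) / 2 ≤ 50 := by
    have h1 := exp_interpolation_radius_le
    have h2 : (Real.exp (23 / 5))⁻¹ ≤ 0.1 := by
      rw [← Real.exp_neg]
      have := Real.add_one_le_exp (23 / 5 : ℝ)
      have e2 : Real.exp (23 / 10) ^ 2 = Real.exp (23 / 5) := by
        rw [← Real.exp_nat_mul]; norm_num
      have := Real.add_one_le_exp (23 / 10 : ℝ)
      have h10 : 10 ≤ Real.exp (23 / 5) := by nlinarith only [this, e2]
      rw [Real.exp_neg, inv_le_comm₀ (by positivity) (by norm_num)]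
      linarith
    linarith
  have H2 := log_interpolation_inequality (Finset.prod_pos fun e _ => hWpos e) hlogW
    (by linarith : 0 < T) hω0 (Real.log_exp _) hϱ hrad (by positivity) H
  obtain ⟨Q, rfl⟩ : ∃ Q, P = Q + 1 := ⟨P - 1, by omega⟩
  have hQ : 0 < Q := by
    by_contra hQ
    have : Q = 0 := by omega
    subst this
    have : (11 : ℝ) * ((0 + 1 : ℕ) : ℝ) = 11 := by norm_num
    rw [this] at hN1
    nlinarith only [hN1, hR4, hm0]
  have hΛ2 : |Λ| ≤ 0.001 := by
    refine hΛ1.trans ?_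
    have h1 := Real.add_one_le_exp (2 * m * X)
    rw [Real.exp_neg]
    have h2 : (4000 : ℝ) ≤ Real.exp (2 * m * X) := by nlinarith only [h1, hX, hm0]
    have h3 : (Real.exp (2 * m * X))⁻¹ ≤ (4000 : ℝ)⁻¹ := by gcongr
    norm_num at h3 ⊢
    linarith
  refine false_of_log_inequality (lc := ∑ k : Fin (Q + 1),
    Real.log (2 * (T / 2) ^ (k : ℕ) / (k : ℕ).factorial)) (P := ((Q + 1 : ℕ) : ℝ)) (Q := Q)
    (N := 11 * ((Q + 1 : ℕ) : ℝ)) (m := m) (R := R) (ν := ν) (T := T) (ω := ω) (S := S)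
    hX hν' hm hR1 hS1 hN1 rfl (by push_cast; ring) hT2 hT1 ?_ hGr hGs
    (Nat.ceil_lt_add_one hGr0).le ?_ (lf := Real.log (11 * (Q + 1)).factorial) ?_ ?_ H2
  · have e1 : (m : ℝ) * ω ≤ ν * X + 0.011 := by
      have h1 := (abs_le.mp (hχ (true, true))).2
      have h2 := (abs_le.mp hΛ2).1
      linarith
    calc ω * T ≤ ω * (R * m / 2) := by gcongr
      _ = R * (m * ω) / 2 := by ring
      _ ≤ _ := by gcongr
  · have hX0 : (0 : ℝ) ≤ ν * X := by linarith
    have A : ∀ e : Bool × Bool, |ν * Real.log (α e.1) + Real.log (n e / d)| ≤ ν * X + 0.01 := by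
      rintro ⟨e1, e2⟩
      refine (abs_add_le _ _).trans (add_le_add ?_ (hχ _))
      cases e1
      · rw [hα0, mul_neg, abs_neg, abs_of_nonneg hX0]
      · rw [hXα, abs_of_nonneg hX0]
    have B1 : |Real.log (β false) - Real.log (α true)| ≤ 2 * X + ω := by
      rw [hβ0, hXα, abs_le]; constructor <;> linarith
    have B2 : |Real.log (β true) - Real.log (α false)| ≤ 2 * X + ω := by
      rw [hα0, hω, abs_le]; constructor <;> linarith
    have B3 : |Real.log (β false) - Real.log (α false)| ≤ ω := by
      rw [hα0, hβ0, abs_le]; constructor <;> linarith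
    have A1 := A (true, false)
    have A2 := A (false, true)
    have A3 := A (false, false)
    refine add_le_add (mul_le_mul_of_nonneg_right ?_ hGr0) (mul_le_mul_of_nonneg_right ?_ hGs0)
    · linarith
    · dsimp only
      linarith
  · have := log_factorial_le (11 * (Q + 1))
    push_cast at this ⊢
    exact this
  · have := sum_log_chebyshev_factor_le Q hQ hT2
    push_cast
    exact this

end BiquadraticUnits

/-- The sequence with `z (n + 2) = w * z (n + 1) - z n`. -/
def recSeq (w z₀ z₁ : ℤ) : ℕ → ℤ
  | 0 => z₀
  | 1 => z₁
  | n + 2 => w * recSeq w z₀ z₁ (n + 1) - recSeq w z₀ z₁ n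

theorem recSeq_two_eq {w z₁ : ℤ} {α α' u : ℝ} (h₁ : α + α' = w) (h₂ : α * α' = 1)
    (h₃ : (z₁ : ℝ) = (1 + u) * α + (1 - u) * α') (n : ℕ) :
    (recSeq w 2 z₁ n : ℝ) = (1 + u) * α ^ n + (1 - u) * α' ^ n := by
  induction n using Nat.twoStepInduction with
  | zero => simp [recSeq]; norm_num
  | one => simpa [recSeq] using h₃
  | more n ih₁ ih₂ =>
    rw [recSeq]
    push_cast
    rw [ih₁, ih₂, ← h₁]
    linear_combination ((1 + u) * α ^ n + (1 - u) * α' ^ n) * h₂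

theorem log_sub_log_le {p q y z : ℝ} (hp : 0 < p) (hq : 0 < q) (hy : 0 ≤ y) (hz : z ≤ 1)
    (h : p + y / p = q + z / q) : Real.log p - Real.log q ≤ 1 / q ^ 2 := by
  rw [← Real.log_div hp.ne' hq.ne']
  refine (Real.log_le_sub_one_of_pos (by positivity)).trans ?_
  have h1 : 0 ≤ y / p := by positivity
  have h2 : z / q ≤ 1 / q := by gcongr
  have e1 : p / q - 1 = (p - q) / q := by field_simp
  have e2 : 1 / q ^ 2 = 1 / q / q := by field_simp
  rw [e1, e2]
  gcongr
  linarith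

theorem abs_log_sub_log_le {p q y z : ℝ} (hp : 0 < p) (hq : 0 < q) (hy : 0 ≤ y) (hy1 : y ≤ 1)
    (hz : 0 ≤ z) (hz1 : z ≤ 1) (h : p + y / p = q + z / q) :
    |Real.log p - Real.log q| ≤ 1 / p ^ 2 + 1 / q ^ 2 := by
  have h1 := log_sub_log_le hp hq hy hz1 h
  have h2 := log_sub_log_le hq hp hz hy1 h.symm
  have h3 : 0 ≤ 1 / p ^ 2 := by positivity
  have h4 : 0 ≤ 1 / q ^ 2 := by positivity
  rw [abs_le]
  constructor <;> linarith

theorem abs_log_one_add_le {u δ : ℝ} (hu : |u| ≤ δ) (hδ : δ < 1) :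
    |Real.log (1 + u)| ≤ δ / (1 - δ) := by
  obtain ⟨h1, h2⟩ := abs_le.mp hu
  have hδ0 : 0 ≤ δ := (abs_nonneg u).trans hu
  have h3 : 0 < 1 + u := by linarith
  have h4 : 0 < 1 - δ := by linarith
  rw [abs_le]
  constructor
  · have := Real.one_sub_inv_le_log_of_pos h3
    have h5 : (1 + u)⁻¹ ≤ (1 - δ)⁻¹ := by gcongr; linarith
    have e : δ / (1 - δ) = (1 - δ)⁻¹ - 1 := by field_simp; ring
    linarith
  · have := Real.log_le_sub_one_of_pos h3
    have : δ ≤ δ / (1 - δ) := by rw [le_div_iff₀ h4]; nlinarith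
    linarith

theorem not_isSquare_sq_sub_four {r : ℤ} (hr : 3 ≤ r) : ¬ IsSquare (r ^ 2 - 4) := by
  rintro ⟨k, hk⟩
  have h1 : |k| ^ 2 = r ^ 2 - 4 := by rw [sq_abs, hk, sq]
  have h2 := abs_nonneg k
  have h3 : |k| < r := by nlinarith
  have h4 : r - 1 ≤ |k| := by
    by_contra h
    push Not at h
    nlinarith
  have h5 : |k| = r - 1 := by omega
  rw [h5] at h1
  have : 2 * r = 5 := by linarith
  omega

/-- The two roots of `X ^ 2 - r X + 1`. -/
noncomputable def unitPair (r : ℤ) (i : Bool) : ℝ :=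
  (r + bif i then √((r : ℝ) ^ 2 - 4) else -√((r : ℝ) ^ 2 - 4)) / 2

theorem unitPair_add (r : ℤ) : unitPair r true + unitPair r false = r := by
  simp only [unitPair, cond_true, cond_false]; ring

theorem unitPair_mul {r : ℤ} (hr : 3 ≤ r) : unitPair r true * unitPair r false = 1 := by
  have hr' : (3 : ℝ) ≤ r := by exact_mod_cast hr
  have := Real.sq_sqrt (show (0 : ℝ) ≤ (r : ℝ) ^ 2 - 4 by nlinarith)
  simp only [unitPair, cond_true, cond_false]
  linear_combination -this / 4

theorem unitPair_true_gt {r : ℤ} (hr : 3 ≤ r) : (r : ℝ) - 1 < unitPair r true := by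
  have hr' : (3 : ℝ) ≤ r := by exact_mod_cast hr
  have : (r : ℝ) - 2 < √((r : ℝ) ^ 2 - 4) := by
    apply Real.lt_sqrt_of_sq_lt
    nlinarith
  simp only [unitPair, cond_true]
  linarith

theorem unitPair_pos {r : ℤ} (hr : 3 ≤ r) (i : Bool) : 0 < unitPair r i := by
  have hr' : (3 : ℝ) ≤ r := by exact_mod_cast hr
  have h1 : 0 < unitPair r true := by linarith [unitPair_true_gt hr]
  cases i
  · have := unitPair_mul hr
    exact pos_of_mul_pos_right (by rw [this]; norm_num) h1.le
  · exact h1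

theorem unitPair_false_eq {r : ℤ} (hr : 3 ≤ r) : unitPair r false = (unitPair r true)⁻¹ :=
  (inv_eq_of_mul_eq_one_right (unitPair_mul hr)).symm

theorem abs_two_mul_unitPair_sub (r : ℤ) (i : Bool) :
    |2 * unitPair r i - r| = √((r : ℝ) ^ 2 - 4) := by
  cases i <;> simp only [unitPair, cond_true, cond_false]
  · rw [show (2 : ℝ) * ((r + -√((r : ℝ) ^ 2 - 4)) / 2) - r = -√((r : ℝ) ^ 2 - 4) by ring, abs_neg,
      abs_of_nonneg (Real.sqrt_nonneg _)]
  · rw [show (2 : ℝ) * ((r + √((r : ℝ) ^ 2 - 4)) / 2) - r = √((r : ℝ) ^ 2 - 4) by ring,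
      abs_of_nonneg (Real.sqrt_nonneg _)]

theorem sq_two_mul_unitPair_sub {r : ℤ} (hr : 3 ≤ r) (i : Bool) :
    (2 * unitPair r i - r) ^ 2 = (r : ℝ) ^ 2 - 4 := by
  have hr' : (3 : ℝ) ≤ r := by exact_mod_cast hr
  rw [← sq_abs, abs_two_mul_unitPair_sub, Real.sq_sqrt (by nlinarith)]

theorem sq_sub_four_le_unitPair_sq {r : ℤ} (hr : 3 ≤ r) :
    (r : ℝ) ^ 2 - 4 ≤ unitPair r true ^ 2 := by
  have h1 := unitPair_add r
  have h2 := unitPair_mul hr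
  have h3 := sq_nonneg (unitPair r false)
  rw [← h1]
  have : unitPair r false < 1 := by linarith [unitPair_true_gt hr]
  have := unitPair_pos hr false
  nlinarith

/-- The coefficient in the closed form of the solutions of the Pell equation attached to `a, b`. -/
noncomputable def pellCoeff (r b σ : ℤ) (i : Bool) : ℝ := σ * (2 * unitPair r i - r) / b

section pellCoeff

variable {r a b σ : ℤ}

theorem pellCoeff_sq (hr : 3 ≤ r) (hb : 0 < b) (hab : a * b = r ^ 2 - 4) (hσ : σ = 1 ∨ σ = -1)
    (i : Bool) : pellCoeff r b σ i ^ 2 = a / b := by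
  have hb' : (0 : ℝ) < b := by exact_mod_cast hb
  have h1 : (a : ℝ) * b = (r : ℝ) ^ 2 - 4 := by exact_mod_cast hab
  have h2 : (σ : ℝ) ^ 2 = 1 := by rcases hσ with rfl | rfl <;> norm_num
  rw [pellCoeff, div_pow, mul_pow, sq_two_mul_unitPair_sub hr, h2, ← h1]
  field_simp

theorem abs_pellCoeff_le (hr : 3 ≤ r) (hb : 0 < b) (hab : a * b = r ^ 2 - 4)
    (hσ : σ = 1 ∨ σ = -1) {δ : ℝ} (hδ : 0 ≤ δ) (h : (a : ℝ) ≤ δ ^ 2 * b) (i : Bool) :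
    |pellCoeff r b σ i| ≤ δ := by
  have hb' : (0 : ℝ) < b := by exact_mod_cast hb
  refine abs_le_of_sq_le_sq ?_ hδ
  rw [pellCoeff_sq hr hb hab hσ, div_le_iff₀ hb']
  exact h

theorem recSeq_eq_add_div (hr : 3 ≤ r) (hb : 0 < b) (hab : a * b = r ^ 2 - 4)
    (hσ : σ = 1 ∨ σ = -1) (h1 : 0 < 1 + pellCoeff r b σ true) (l : ℕ) :
    (recSeq r 2 (r + σ * a) l : ℝ) = (1 + pellCoeff r b σ true) * unitPair r true ^ l
      + (1 - a / b) / ((1 + pellCoeff r b σ true) * unitPair r true ^ l) := by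
  have hb' : (b : ℝ) ≠ 0 := by exact_mod_cast hb.ne'
  have hα := unitPair_pos hr true
  rw [recSeq_two_eq (unitPair_add r) (unitPair_mul hr) (u := pellCoeff r b σ true), ←
    pellCoeff_sq hr hb hab hσ true, unitPair_false_eq hr, inv_pow]
  · field_simp
    ring
  · have h2 := sq_two_mul_unitPair_sub hr true
    have h3 : (a : ℝ) * b = (r : ℝ) ^ 2 - 4 := by exact_mod_cast hab
    have h4 := unitPair_add r
    push_cast
    rw [pellCoeff, ← sub_eq_iff_eq_add'.mpr h4.symm]
    field_simp
    rw [← h3] at h2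
    linear_combination (-(σ : ℝ)) * h2

end pellCoeff

/-- A linear form in logarithms is small when two sequences have a common term. -/
theorem abs_linear_form_le {α β u v y z : ℝ} {k l m : ℕ} (hα : 1 ≤ α) (hαβ : α ≤ β)
    (hu : |u| ≤ 0.01) (hv : |v| ≤ 0.01) (hy : 0 ≤ y) (hy1 : y ≤ 1) (hz : 0 ≤ z) (hz1 : z ≤ 1)
    (hkl : k ≤ l) (hkm : k ≤ m)
    (h : (1 + u) * α ^ l + y / ((1 + u) * α ^ l) = (1 + v) * β ^ m + z / ((1 + v) * β ^ m)) :
    |l * Real.log α + Real.log ((1 + u) / (1 + v)) - m * Real.log β|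
      ≤ 4 * Real.exp (-(2 * k * Real.log α)) := by
  have hα0 : 0 < α := by linarith
  have hβ0 : 0 < β := by linarith
  have hu1 := (abs_le.mp hu).1
  have hv1 := (abs_le.mp hv).1
  have hu0 : 0.99 ≤ 1 + u := by linarith
  have hv0 : 0.99 ≤ 1 + v := by linarith
  have hup : 0 < 1 + u := by linarith
  have hvp : 0 < 1 + v := by linarith
  have h1 := abs_log_sub_log_le (by positivity) (by positivity) hy hy1 hz hz1 h
  rw [Real.log_mul hup.ne' (by positivity), Real.log_mul hvp.ne' (by positivity), Real.log_pow,
    Real.log_pow] at h1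
  rw [Real.log_div hup.ne' hvp.ne']
  have e : l * Real.log α + (Real.log (1 + u) - Real.log (1 + v)) - m * Real.log β
      = Real.log (1 + u) + l * Real.log α - (Real.log (1 + v) + m * Real.log β) := by ring
  rw [e]
  refine h1.trans ?_
  have hexp : Real.exp (-(2 * k * Real.log α)) = 1 / (α ^ k) ^ 2 := by
    rw [Real.exp_neg, show 2 * (k : ℝ) * Real.log α = (2 * k : ℕ) * Real.log α by push_cast; ring,
      Real.exp_nat_mul, Real.exp_log hα0, mul_comm 2 k, pow_mul, one_div]
  rw [hexp]
  have hk0 : 0 < α ^ k := by positivity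
  have k1 : α ^ k ≤ α ^ l := pow_le_pow_right₀ hα hkl
  have k2 : α ^ k ≤ β ^ m :=
    (pow_le_pow_right₀ hα hkm).trans (pow_le_pow_left₀ hα0.le hαβ m)
  have g : ∀ w : ℝ, 0.99 * α ^ k ≤ w → 1 / w ^ 2 ≤ 2 * (1 / (α ^ k) ^ 2) := by
    intro w hw
    calc 1 / w ^ 2 ≤ 1 / (0.99 * α ^ k) ^ 2 := by gcongr
      _ = 1 / 0.99 ^ 2 * (1 / (α ^ k) ^ 2) := by field_simp
      _ ≤ _ := by gcongr; norm_num
  have g1 := g ((1 + u) * α ^ l) (by gcongr)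
  have g2 := g ((1 + v) * β ^ m) (by gcongr)
  linarith

theorem exp_lt_2798 : Real.exp 7.9 < 2798 := by
  have h1 : Real.exp 8 < 2982 := by
    rw [show (8 : ℝ) = (8 : ℕ) * 1 by norm_num, Real.exp_nat_mul]
    calc Real.exp 1 ^ 8 ≤ 2.7182818286 ^ 8 := by gcongr; exact Real.exp_one_lt_d9.le
      _ < 2982 := by norm_num
  have h2 : (1.1 : ℝ) ≤ Real.exp 0.1 := by linarith [Real.add_one_le_exp (0.1 : ℝ)]
  have h3 : Real.exp 8 = Real.exp 7.9 * Real.exp 0.1 := by rw [← Real.exp_add]; norm_num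
  have h4 := Real.exp_pos 7.9
  nlinarith

section unitPair

variable {r k : ℤ}

theorem unitPair_true_lt (hr : 3 ≤ r) : unitPair r true < r := by
  linarith [unitPair_add r, unitPair_pos hr false]

theorem unitPair_true_lt_unitPair_add (hr : 3 ≤ r) (hk : 0 < k) :
    unitPair r true < unitPair (r + k) true := by
  have h1 := unitPair_true_lt hr
  have h2 := unitPair_true_gt (show 3 ≤ r + k by lia)
  have hk' : (1 : ℝ) ≤ k := by exact_mod_cast hk
  push_cast at h2
  linarith

theorem log_unitPair_ge (hr : 2799 ≤ r) : 7.9 ≤ Real.log (unitPair r true) := by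
  have hr' : (2799 : ℝ) ≤ r := by exact_mod_cast hr
  have h1 := unitPair_true_gt (show 3 ≤ r by lia)
  rw [Real.le_log_iff_exp_le (by linarith)]
  linarith [exp_lt_2798]

theorem log_unitPair_add_sub_le (hr : 2795 * k + 3 ≤ r) (hk : 0 < k) :
    Real.log (unitPair (r + k) true) - Real.log (unitPair r true) ≤ 1 / 2795 := by
  have hr3 : 3 ≤ r := by lia
  have hr' : (2795 : ℝ) * k + 3 ≤ r := by exact_mod_cast hr
  have hk' : (1 : ℝ) ≤ k := by exact_mod_cast hk
  have hα := unitPair_pos hr3 true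
  have hβ := unitPair_pos (show 3 ≤ r + k by lia) true
  have h1 := unitPair_true_lt (show 3 ≤ r + k by lia)
  have h2 := unitPair_true_gt hr3
  have h3 := unitPair_add r
  have h4 := unitPair_mul hr3
  have h5 : unitPair r false ≤ 0.001 := by nlinarith [unitPair_pos hr3 false]
  push_cast at h1
  rw [← Real.log_div hβ.ne' hα.ne']
  refine (Real.log_le_sub_one_of_pos (by positivity)).trans ?_
  rw [sub_le_iff_le_add, div_le_iff₀ hα]
  linarith

theorem le_log_unitPair_add_sub (hr : 3 ≤ r) (hk : 0 < k) :
    (k : ℝ) / (r + k) ≤ Real.log (unitPair (r + k) true) - Real.log (unitPair r true) := by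
  have hr' : (3 : ℝ) ≤ r := by exact_mod_cast hr
  have hk' : (1 : ℝ) ≤ k := by exact_mod_cast hk
  have hα := unitPair_pos hr true
  have hβ := unitPair_pos (show 3 ≤ r + k by lia) true
  have h0 := unitPair_true_lt_unitPair_add hr hk
  have h1 := unitPair_add r
  have h2 := unitPair_mul hr
  have h3 := unitPair_add (r + k)
  have h4 := unitPair_mul (show 3 ≤ r + k by lia)
  have h5 : unitPair (r + k) false ≤ unitPair r false := by
    rw [unitPair_false_eq hr, unitPair_false_eq (by lia)]; gcongr
  rw [← Real.log_div hβ.ne' hα.ne']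
  refine le_trans ?_ (Real.one_sub_inv_le_log_of_pos (by positivity))
  rw [inv_div, le_sub_comm, div_le_iff₀ hβ]
  have e : 1 - (k : ℝ) / (r + k) = r / (r + k) := by field_simp; ring
  rw [e, div_mul_eq_mul_div, le_div_iff₀ (by linarith)]
  push_cast at h3
  rw [← h3, ← h1]
  nlinarith [unitPair_pos hr false, unitPair_pos (show 3 ≤ r + k by lia) false]

end unitPair

theorem abs_log_one_add_div_le {u v δ : ℝ} (hu : |u| ≤ δ) (hv : |v| ≤ δ) (hδ : δ < 1) :
    |Real.log ((1 + u) / (1 + v))| ≤ 2 * (δ / (1 - δ)) := by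
  have h1 := (abs_le.mp hu).1
  have h2 := (abs_le.mp hv).1
  rw [Real.log_div (by linarith) (by linarith)]
  refine (abs_sub _ _).trans ?_
  linarith [abs_log_one_add_le hu hδ, abs_log_one_add_le hv hδ]

theorem biquadraticUnits_unitPair {r s t a b c : ℤ} (hr : 3 ≤ r) (hs : 3 ≤ s) (ht : 3 ≤ t)
    (ha : a ≠ 0) (hab : a * b = r ^ 2 - 4) (hac : a * c = s ^ 2 - 4) (hbc : b * c = t ^ 2 - 4) :
    BiquadraticUnits r s (unitPair r) (unitPair s) where
  add_left := unitPair_add r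
  mul_left := unitPair_mul hr
  add_right := unitPair_add s
  mul_right := unitPair_mul hs
  not_isSquare_left := not_isSquare_sq_sub_four hr
  not_isSquare_right := not_isSquare_sq_sub_four hs
  not_isSquare_mul := by
    rintro ⟨x, hx⟩
    have h : a ^ 2 * (t ^ 2 - 4) = x ^ 2 := by
      rw [← hab, ← hac] at hx
      rw [← hbc, pow_two x, ← hx]; ring
    obtain ⟨y, rfl⟩ : a ∣ x := by
      rw [← Int.pow_dvd_pow_iff two_ne_zero]; exact ⟨_, h.symm⟩
    refine not_isSquare_sq_sub_four ht ⟨y, ?_⟩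
    have : a ^ 2 ≠ 0 := pow_ne_zero 2 ha
    apply mul_left_cancel₀ this
    rw [h]; ring

/-- The numerators of the coefficients of the linear form attached to two Pell equations. -/
noncomputable def pellNumer (r s b c σ τ : ℤ) (e : Bool × Bool) : ℝ :=
  (b + σ * (2 * unitPair r e.1 - r)) * (c - τ * (2 * unitPair s e.2 - s))

theorem pellNumer_mem_order {r s b c σ τ : ℤ}
    (h : BiquadraticUnits r s (unitPair r) (unitPair s)) : pellNumer r s b c σ τ ∈ h.order := by
  have hz : ∀ n : ℤ, (fun _ => (n : ℝ)) ∈ h.order := fun n => intCast_mem h.order n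
  have h1 : (fun e : Bool × Bool => (b : ℝ) + σ * (2 * unitPair r e.1 - r)) ∈ h.order := by
    have h2 : (fun _ => (2 : ℝ)) ∈ h.order := by simpa using hz 2
    exact h.order.add_mem (hz b)
      (h.order.mul_mem (hz σ) (h.order.sub_mem (h.order.mul_mem h2 h.left_mem) (hz r)))
  have h3 : (fun e : Bool × Bool => (c : ℝ) - τ * (2 * unitPair s e.2 - s)) ∈ h.order := by
    have h2 : (fun _ => (2 : ℝ)) ∈ h.order := by simpa using hz 2
    exact h.order.sub_mem (hz c)
      (h.order.mul_mem (hz τ) (h.order.sub_mem (h.order.mul_mem h2 h.right_mem) (hz s)))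
  exact h.order.mul_mem h1 h3

theorem pellNumer_eq {r s a b c σ τ : ℤ} (hs : 3 ≤ s) (hb : 0 < b) (hc : 0 < c)
    (hac : a * c = s ^ 2 - 4) (hτ : τ = 1 ∨ τ = -1) (e : Bool × Bool)
    (h0 : 0 < 1 + pellCoeff s c τ e.2) :
    pellNumer r s b c σ τ e
      = (1 + pellCoeff r b σ e.1) / (1 + pellCoeff s c τ e.2) * (b * (c - a) : ℤ) := by
  have hb' : (b : ℝ) ≠ 0 := by exact_mod_cast hb.ne'
  have hc' : (c : ℝ) ≠ 0 := by exact_mod_cast hc.ne'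
  have h1 := pellCoeff_sq hs hc hac hτ e.2
  have h2 : (1 + pellCoeff s c τ e.2) * (1 - pellCoeff s c τ e.2) * c = (c - a : ℤ) := by
    rw [← sq_sub_sq, h1]; push_cast; field_simp
  have h3 : (b : ℝ) + σ * (2 * unitPair r e.1 - r) = b * (1 + pellCoeff r b σ e.1) := by
    rw [pellCoeff]; field_simp
  have h4 : (c : ℝ) - τ * (2 * unitPair s e.2 - s) = c * (1 - pellCoeff s c τ e.2) := by
    rw [pellCoeff]; field_simp
  rw [pellNumer, h3, h4, Int.cast_mul, ← h2]
  field_simp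

theorem recSeq_add_ne_of_lt_three {r k σ τ : ℤ} (hk : 0 < k) (hr : 3 ≤ r)
    (hσ : σ = 1 ∨ σ = -1) (hτ : τ = 1 ∨ τ = -1) {l : ℕ} (hl : l < 3)
    (h2 : recSeq r 2 (r + σ * k) l ≠ 2)
    (hrs : recSeq r 2 (r + σ * k) l ≠ r * (r + k) - 2) :
    recSeq r 2 (r + σ * k) l ≠ recSeq (r + k) 2 (r + k + τ * k) l := by
  intro h
  interval_cases l <;> simp only [recSeq] at h h2 hrs
  · exact h2 rfl
  · rcases hσ with rfl | rfl <;> rcases hτ with rfl | rfl <;> lia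
  · rcases hσ with rfl | rfl <;> rcases hτ with rfl | rfl
    · nlinarith
    · exact hrs (by ring)
    · nlinarith
    · nlinarith

/-- Data for two Pell equations whose fundamental units are `(r + √(r² - 4)) / 2` and
`(r + k + √((r + k)² - 4)) / 2`. -/
structure PellPair (A k r t b c : ℤ) : Prop where
  le : 2801 ≤ A
  pos : 0 < k
  sub_two_le : A * k - 2 ≤ r
  le_add_two : r ≤ A * k + 2
  left : k * b = r ^ 2 - 4
  right : k * c = (r + k) ^ 2 - 4
  mul : b * c = t ^ 2 - 4
  three_le : 3 ≤ t
  lt : b < c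
  sq_mul_le : (A - 3) ^ 2 * k ≤ b

namespace PellPair

variable {A k r t b c σ τ : ℤ} {l m : ℕ}

theorem r_ge (h : PellPair A k r t b c) : 2799 ≤ r := by
  nlinarith [h.le, h.pos, h.sub_two_le]

theorem mul_le (h : PellPair A k r t b c) : 2795 * k + 3 ≤ r := by
  nlinarith [h.le, h.pos, h.sub_two_le]

theorem b_pos (h : PellPair A k r t b c) : 0 < b := by
  have := h.left
  have := h.r_ge
  have := h.pos
  by_contra!
  nlinarith

theorem c_pos (h : PellPair A k r t b c) : 0 < c := h.b_pos.trans h.lt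

theorem units (h : PellPair A k r t b c) :
    BiquadraticUnits r (r + k) (unitPair r) (unitPair (r + k)) :=
  biquadraticUnits_unitPair (by linarith [h.r_ge]) (by linarith [h.r_ge, h.pos]) h.three_le
    h.pos.ne' h.left h.right h.mul

theorem le_real (h : PellPair A k r t b c) : (2801 : ℝ) ≤ A := by exact_mod_cast h.le

theorem mul_le_left (h : PellPair A k r t b c) : (k : ℝ) ≤ (1 / ((A : ℝ) - 3)) ^ 2 * b := by
  have h1 := h.le_real
  have h2 : ((A : ℝ) - 3) ^ 2 * k ≤ b := by exact_mod_cast h.sq_mul_le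
  have : 0 < (A : ℝ) - 3 := by linarith
  rw [div_pow, one_pow, div_mul_eq_mul_div, one_mul, le_div_iff₀ (by positivity)]
  linarith

theorem abs_left_le (h : PellPair A k r t b c) (hσ : σ = 1 ∨ σ = -1) (i : Bool) :
    |pellCoeff r b σ i| ≤ 1 / ((A : ℝ) - 3) :=
  abs_pellCoeff_le (by linarith [h.r_ge]) h.b_pos h.left hσ
    (by have := h.le_real; exact one_div_nonneg.mpr (by linarith)) h.mul_le_left i

theorem abs_right_le (h : PellPair A k r t b c) (hτ : τ = 1 ∨ τ = -1) (i : Bool) :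
    |pellCoeff (r + k) c τ i| ≤ 1 / ((A : ℝ) - 3) := by
  refine abs_pellCoeff_le (by linarith [h.r_ge, h.pos]) h.c_pos h.right hτ
    (by have := h.le_real; exact one_div_nonneg.mpr (by linarith)) (h.mul_le_left.trans ?_) i
  have : (b : ℝ) ≤ c := by exact_mod_cast h.lt.le
  gcongr

theorem one_div_le (h : PellPair A k r t b c) : 1 / ((A : ℝ) - 3) ≤ 1 / 2798 := by
  have := h.le_real
  exact one_div_le_one_div_of_le (by norm_num) (by linarith)

theorem abs_linear_form_le (h : PellPair A k r t b c) (hσ : σ = 1 ∨ σ = -1)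
    (hτ : τ = 1 ∨ τ = -1) {j : ℕ} (hjl : j ≤ l) (hjm : j ≤ m)
    (hlm : recSeq r 2 (r + σ * k) l = recSeq (r + k) 2 (r + k + τ * k) m) :
    |l * Real.log (unitPair r true)
        + Real.log ((1 + pellCoeff r b σ true) / (1 + pellCoeff (r + k) c τ true))
        - m * Real.log (unitPair (r + k) true)|
      ≤ 4 * Real.exp (-(2 * j * Real.log (unitPair r true))) := by
  have hr := h.r_ge
  have hk := h.pos
  have hu := (h.abs_left_le hσ true).trans h.one_div_le
  have hv := (h.abs_right_le hτ true).trans h.one_div_le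
  have hu1 := (abs_le.mp hu).1
  have hv1 := (abs_le.mp hv).1
  have hr3 : (2799 : ℝ) ≤ r := by exact_mod_cast hr
  have hα := unitPair_true_gt (show 3 ≤ r by lia)
  have key : ∀ x : ℤ, 0 < x → k ≤ x → 0 ≤ 1 - (k : ℝ) / x ∧ 1 - (k : ℝ) / x ≤ 1 := by
    intro x hx hkx
    have hx' : (0 : ℝ) < x := by exact_mod_cast hx
    have hk' : (0 : ℝ) < k := by exact_mod_cast hk
    have hkx' : (k : ℝ) ≤ x := by exact_mod_cast hkx
    have : (k : ℝ) / x ≤ 1 := by rwa [div_le_one hx']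
    have : 0 ≤ (k : ℝ) / x := by positivity
    constructor <;> linarith
  have hkb : k ≤ b := by
    have : 1 ≤ (A - 3) ^ 2 := by nlinarith [h.le]
    nlinarith [h.sq_mul_le]
  obtain ⟨hy, hy1⟩ := key b h.b_pos hkb
  obtain ⟨hz, hz1⟩ := key c h.c_pos (hkb.trans h.lt.le)
  refine _root_.abs_linear_form_le (by linarith)
    (unitPair_true_lt_unitPair_add (by lia) hk).le (hu.trans (by norm_num))
    (hv.trans (by norm_num)) hy hy1 hz hz1 hjl hjm ?_
  rw [← recSeq_eq_add_div (by lia) h.b_pos h.left hσ (by linarith),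
    ← recSeq_eq_add_div (by lia) h.c_pos h.right hτ (by linarith), hlm]

theorem abs_log_le (h : PellPair A k r t b c) (hσ : σ = 1 ∨ σ = -1) (hτ : τ = 1 ∨ τ = -1)
    (i j : Bool) :
    |Real.log ((1 + pellCoeff r b σ i) / (1 + pellCoeff (r + k) c τ j))| ≤ 2 / ((A : ℝ) - 4) := by
  have h1 := h.le_real
  have h2 : (A : ℝ) - 3 ≠ 0 := by linarith
  have h3 : (A : ℝ) - 4 ≠ 0 := by linarith
  refine (abs_log_one_add_div_le (h.abs_left_le hσ i) (h.abs_right_le hτ j)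
    (h.one_div_le.trans_lt (by norm_num))).trans_eq ?_
  have : (1 : ℝ) - 1 / (A - 3) = (A - 4) / (A - 3) := by field_simp; ring
  rw [this]
  field_simp

theorem two_div_le (h : PellPair A k r t b c) : 2 / ((A : ℝ) - 4) ≤ 2 / 2797 := by
  have := h.le_real
  exact div_le_div_of_nonneg_left (by norm_num) (by norm_num) (by linarith)

theorem pellNumer_eq (h : PellPair A k r t b c) (hτ : τ = 1 ∨ τ = -1) (e : Bool × Bool) :
    pellNumer r (r + k) b c σ τ e
      = (1 + pellCoeff r b σ e.1) / (1 + pellCoeff (r + k) c τ e.2) * (b * (c - k) : ℤ) := by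
  have hv := (h.abs_right_le hτ e.2).trans h.one_div_le
  exact _root_.pellNumer_eq (by linarith [h.r_ge, h.pos]) h.b_pos h.c_pos h.right hτ e
    (by linarith [(abs_le.mp hv).1])

theorem lt_c (h : PellPair A k r t b c) : k < c := by
  have : 1 ≤ (A - 3) ^ 2 := by nlinarith [h.le]
  nlinarith [h.sq_mul_le, h.lt, h.pos]

/-- The two unknown indices cannot be close to each other. -/
theorem add_two_le (h : PellPair A k r t b c) (hσ : σ = 1 ∨ σ = -1) (hτ : τ = 1 ∨ τ = -1)
    (hpar : l % 2 = m % 2)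
    (hlm : recSeq r 2 (r + σ * k) l = recSeq (r + k) 2 (r + k + τ * k) m)
    (h2 : recSeq r 2 (r + σ * k) l ≠ 2)
    (hrs : recSeq r 2 (r + σ * k) l ≠ r * (r + k) - 2) : m + 2 ≤ l := by
  have hr := h.r_ge
  have hk := h.pos
  have hX := log_unitPair_ge hr
  have hω := le_log_unitPair_add_sub (show 3 ≤ r by lia) hk
  have hA := h.le_real
  have hχ := h.abs_log_le hσ hτ true true
  have hlt := Real.log_lt_log (unitPair_pos (by lia) true)
    (unitPair_true_lt_unitPair_add (show 3 ≤ r by lia) hk)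
  by_contra! hlt'
  obtain hml | rfl : l + 2 ≤ m ∨ l = m := by lia
  · have hΛ := h.abs_linear_form_le hσ hτ (Nat.zero_le l) (Nat.zero_le m) hlm
    have h1 : ((l : ℝ) + 2) ≤ m := by exact_mod_cast hml
    have h3 := h.two_div_le
    norm_num at hΛ
    rw [abs_le] at hΛ hχ
    nlinarith
  · have hl3 : 3 ≤ l := by
      by_contra! hl
      exact recSeq_add_ne_of_lt_three hk (by lia) hσ hτ hl h2 hrs hlm
    have hΛ := h.abs_linear_form_le hσ hτ le_rfl le_rfl hlm
    have hr' : (A : ℝ) - 3 ≤ r - 1 := by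
      have h1 : A - 2 ≤ r := by nlinarith [h.sub_two_le, h.le]
      have h1' : (A : ℝ) - 2 ≤ r := by exact_mod_cast h1
      linarith
    have hα := unitPair_true_gt (show 3 ≤ r by lia)
    have hα0 := unitPair_pos (show 3 ≤ r by lia) true
    have hl : (3 : ℝ) ≤ l := by exact_mod_cast hl3
    have hexp : Real.exp (-(2 * l * Real.log (unitPair r true))) ≤ 1 / (2798 * (A - 3)) := by
      calc Real.exp (-(2 * l * Real.log (unitPair r true)))
          ≤ Real.exp (-(2 * Real.log (unitPair r true))) := by
            rw [Real.exp_le_exp]; nlinarith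
        _ = 1 / (unitPair r true * unitPair r true) := by
            rw [Real.exp_neg, two_mul, Real.exp_add, Real.exp_log hα0, one_div]
        _ ≤ _ := by
            have : 2798 ≤ unitPair r true := by
              have : (2799 : ℝ) ≤ r := by exact_mod_cast hr
              linarith
            apply one_div_le_one_div_of_le (by nlinarith)
            gcongr
            · linarith
            · exact hr'.trans hα.le
    have hω' : 1 / ((A : ℝ) + 3) ≤ (k : ℝ) / (r + k) := by
      have h1 : r + k ≤ (A + 3) * k := by nlinarith [h.le_add_two]
      have h1' : (r : ℝ) + k ≤ (A + 3) * k := by exact_mod_cast h1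
      have h2' : (0 : ℝ) < k := by exact_mod_cast hk
      have h3' : (2799 : ℝ) ≤ r := by exact_mod_cast hr
      rw [div_le_div_iff₀ (by linarith) (by linarith)]
      linarith
    have key : 2 / ((A : ℝ) - 4) + 4 * (1 / (2798 * (A - 3))) < 3 * (1 / ((A : ℝ) + 3)) := by
      have h1 : 0 < (A : ℝ) - 4 := by linarith
      have h2 : 0 < (A : ℝ) - 3 := by linarith
      have h3 : 0 < (A : ℝ) + 3 := by linarith
      have h4 : 1 / (2798 * ((A : ℝ) - 3)) ≤ 1 / (2798 * (A - 4)) := by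
        gcongr
        linarith
      have h5 : 2 / ((A : ℝ) - 4) + 4 * (1 / (2798 * (A - 4))) = 2.0015 / (A - 4)
          - (0.0015 - 4 / 2798) / (A - 4) := by field_simp; ring
      have h6 : 0 ≤ (0.0015 - 4 / 2798) / ((A : ℝ) - 4) := by
        apply div_nonneg _ h1.le; norm_num
      have h7 : 2.0015 / ((A : ℝ) - 4) < 3 * (1 / ((A : ℝ) + 3)) := by
        rw [mul_one_div, div_lt_div_iff₀ h1 h3]; linarith
      linarith
    have h8 : 3 * (1 / ((A : ℝ) + 3)) ≤ l * (Real.log (unitPair (r + k) true)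
        - Real.log (unitPair r true)) := by gcongr; exact hω'.trans hω
    rw [abs_le] at hΛ hχ
    linarith

theorem false_of_add_two_le (h : PellPair A k r t b c) (hσ : σ = 1 ∨ σ = -1)
    (hτ : τ = 1 ∨ τ = -1)
    (hlm : recSeq r 2 (r + σ * k) l = recSeq (r + k) 2 (r + k + τ * k) m) (hml : m + 2 ≤ l) :
    False := by
  have hr := h.r_ge
  have hk := h.pos
  have hb := h.b_pos
  have hc := h.c_pos
  have hX := log_unitPair_ge hr
  have hω := log_unitPair_add_sub_le h.mul_le hk
  have hχ (i j : Bool) := (h.abs_log_le hσ hτ i j).trans h.two_div_le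
  have hlt := Real.log_lt_log (unitPair_pos (by lia) true)
    (unitPair_true_lt_unitPair_add (show 3 ≤ r by lia) hk)
  have hα := unitPair_pos (show 3 ≤ r by lia) true
  have hβ := unitPair_pos (show 3 ≤ r + k by lia) true
  obtain ⟨ν, rfl⟩ := Nat.exists_eq_add_of_le' (show m ≤ l by lia)
  have hν : 2 ≤ ν := by lia
  set X := Real.log (unitPair r true) with hXdef
  set Y := Real.log (unitPair (r + k) true) with hYdef
  have hν' : (2 : ℝ) ≤ ν := by exact_mod_cast hν
  have hΛ0 := h.abs_linear_form_le hσ hτ (Nat.zero_le _) (Nat.zero_le m) hlm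
  have hΛ := h.abs_linear_form_le hσ hτ (Nat.le_add_left m ν) le_rfl hlm
  have hc1 := abs_le.mp (hχ true true)
  rw [← hXdef, ← hYdef] at hΛ hΛ0
  have hm1 : 1 ≤ m := by
    by_contra! hm
    obtain rfl : m = 0 := by lia
    norm_num at hΛ0
    nlinarith [abs_le.mp hΛ0]
  have hm1' : (1 : ℝ) ≤ m := by exact_mod_cast hm1
  have hexp : Real.exp (-(2 * m * X)) ≤ 1 / 2000 := by
    rw [Real.exp_neg, one_div]
    gcongr
    have h1 : Real.exp 15.8 ≤ Real.exp (2 * m * X) := by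
      rw [Real.exp_le_exp]; nlinarith
    have h2 : Real.exp 15.8 = Real.exp 7.9 * Real.exp 7.9 := by
      rw [← Real.exp_add]; norm_num
    have h3 : (2 : ℝ) ^ 7 ≤ Real.exp 7 := by
      have h4 : (2 : ℝ) ≤ Real.exp 1 := by linarith [Real.add_one_le_exp (1 : ℝ)]
      calc (2 : ℝ) ^ 7 ≤ Real.exp 1 ^ 7 := by gcongr
        _ = Real.exp 7 := by rw [← Real.exp_nat_mul]; norm_num
    have h5 : Real.exp 7 ≤ Real.exp 7.9 := by rw [Real.exp_le_exp]; norm_num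
    nlinarith
  have hm : 2790 * ν * X ≤ m := by
    have h1 := (abs_le.mp hΛ).2
    push_cast at h1
    have h2 : ν * X - 0.01 ≤ m * (Y - X) := by nlinarith [hc1.1]
    have h3 : m * (Y - X) ≤ m * (1 / 2795) := by gcongr
    nlinarith
  set n := pellNumer r (r + k) b c σ τ with hn
  have hd0 : 0 < b * (c - k) := mul_pos hb (by linarith [h.lt_c])
  obtain ⟨D, hD⟩ : ∃ D : ℕ, (D : ℤ) = b * (c - k) := ⟨_, Int.toNat_of_nonneg hd0.le⟩
  have hDpos : 0 < D := by lia
  have hD0 : (0 : ℝ) < D := by exact_mod_cast hDpos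
  have hDr : ((b * (c - k) : ℤ) : ℝ) = D := by exact_mod_cast hD.symm
  have hratio (e : Bool × Bool) :
      n e / D = (1 + pellCoeff r b σ e.1) / (1 + pellCoeff (r + k) c τ e.2) := by
    rw [hn, h.pellNumer_eq hτ e, hDr, mul_div_assoc, div_self hD0.ne', mul_one]
  have hpos (e : Bool × Bool) : 0 < n e := by
    have h1 := (h.abs_left_le hσ e.1).trans h.one_div_le
    have h2 := (h.abs_right_le hτ e.2).trans h.one_div_le
    rw [← div_pos_iff_of_pos_right hD0, hratio]
    apply div_pos <;> linarith [(abs_le.mp h1).1, (abs_le.mp h2).1]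
  have hlogD : Real.log D ≤ 4 * X + 2 * (Y - X) := by
    have h1 : (D : ℝ) ≤ unitPair r true ^ 2 * unitPair (r + k) true ^ 2 := by
      have e1 := sq_sub_four_le_unitPair_sq (show 3 ≤ r by lia)
      have e2 := sq_sub_four_le_unitPair_sq (show 3 ≤ r + k by lia)
      have e3 : ((b * k : ℤ) : ℝ) = (r : ℝ) ^ 2 - 4 := by
        rw [mul_comm, h.left]; push_cast; ring
      have e4 : ((c * k : ℤ) : ℝ) = ((r + k : ℤ) : ℝ) ^ 2 - 4 := by
        rw [mul_comm, h.right]; push_cast; ring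
      have e5 : (D : ℝ) ≤ (b * k : ℤ) * (c * k : ℤ) := by
        rw [← hDr]
        norm_cast
        have : b * (c - k) ≤ b * c := by gcongr; linarith
        have : b * c ≤ b * k * (c * k) := by
          have : b ≤ b * k := by nlinarith
          have : c ≤ c * k := by nlinarith
          gcongr
        linarith
      rw [e3, e4] at e5
      refine e5.trans (mul_le_mul e1 e2 ?_ (by positivity))
      rw [← e4]
      have : 0 < c * k := by positivity
      exact_mod_cast this.le
    have h2 := Real.log_le_log hD0 h1
    rw [Real.log_mul (by positivity) (by positivity), Real.log_pow, Real.log_pow] at h2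
    push_cast at h2
    linarith
  have hlogn (e : Bool × Bool) : |Real.log (n e / D)| ≤ 2 / 2797 := by
    rw [hratio]; exact hχ _ _
  have hΛ' : |ν * X + Real.log (n (true, true) / D) - m * (Y - X)|
      ≤ 4 * Real.exp (-(2 * m * X)) := by
    rw [hratio]
    refine le_of_eq_of_le ?_ hΛ
    push_cast
    ring_nf
  refine h.units.false_of_linear_form_small (unitPair_pos (by lia)) (unitPair_pos (by lia)) n
    (pellNumer_mem_order h.units) hpos D hDpos ν m (X := X) (ω := Y - X)
    hXdef.symm hX (by ring) (by linarith) (by linarith)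
    (fun e => (hlogn e).trans (by norm_num)) (fun e => ?_) hν hm (by ring) hΛ'
  have h1 := (abs_le.mp (hlogn e)).2
  rw [Real.log_div (hpos e).ne' hD0.ne'] at h1
  rw [Real.log_mul (hpos e).ne' hD0.ne']
  linarith

end PellPair

/-- `(X, Z)` solves `X ^ 2 = p * d + 4`, `Z ^ 2 = q * d + 4` with `X` positive. -/
structure PellSol (p q d X Z : ℤ) : Prop where
  left : X ^ 2 = p * d + 4
  right : Z ^ 2 = q * d + 4
  pos : 0 < X
  nonneg : 0 ≤ d

section descent

variable {p q w : ℤ}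

theorem even_sub_of_sq_eq {X Z d : ℤ} (hw : w ^ 2 = p * q + 4) (hX : X ^ 2 = p * d + 4)
    (hZ : Z ^ 2 = q * d + 4) :
    Even (w * X - p * Z) ∧ Even (w * Z - q * X) ∧ Even (p * q * d - w * X * Z) := by
  have h4 : Even (4 : ℤ) := by decide
  have h1 : Even w ↔ (Even p ∨ Even q) := by
    have := congrArg Even hw
    simpa [Int.even_pow, Int.even_add, Int.even_mul, h4] using this
  have h2 : Even X ↔ (Even p ∨ Even d) := by
    have := congrArg Even hX
    simpa [Int.even_pow, Int.even_add, Int.even_mul, h4] using this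
  have h3 : Even Z ↔ (Even q ∨ Even d) := by
    have := congrArg Even hZ
    simpa [Int.even_pow, Int.even_add, Int.even_mul, h4] using this
  simp only [Int.even_sub, Int.even_mul, h1, h2, h3]
  tauto

theorem PellSol.exists_pred (hp : 0 < p) (hpq : p < q) (hq : 4 < q) (hw0 : 0 < w)
    (hw : w ^ 2 = p * q + 4) {d X Z : ℤ} (h : PellSol p q d X Z) :
    ∃ d' X' Z', PellSol p q d' X' Z' ∧ 2 * X' = w * X - p * Z ∧ 2 * Z' = w * Z - q * X := by
  obtain ⟨⟨X', hX'⟩, ⟨Z', hZ'⟩, ⟨e, he⟩⟩ := even_sub_of_sq_eq hw h.left h.right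
  have hX0 := h.left
  have hZ0 := h.right
  have hX2 : 2 * X' = w * X - p * Z := by lia
  have hZ2 : 2 * Z' = w * Z - q * X := by lia
  have e1 : X' ^ 2 = p * (p + q + d + e) + 4 := by
    have : 4 * X' ^ 2 = 4 * (p * (p + q + d + e) + 4) := by
      calc 4 * X' ^ 2 = (2 * X') ^ 2 := by ring
        _ = _ := by
          rw [hX2]
          linear_combination X ^ 2 * hw + (p * q + 4) * hX0 + p ^ 2 * hZ0 + 2 * p * he
    lia
  have e2 : Z' ^ 2 = q * (p + q + d + e) + 4 := by
    have : 4 * Z' ^ 2 = 4 * (q * (p + q + d + e) + 4) := by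
      calc 4 * Z' ^ 2 = (2 * Z') ^ 2 := by ring
        _ = _ := by
          rw [hZ2]
          linear_combination Z ^ 2 * hw + (p * q + 4) * hZ0 + q ^ 2 * hX0 + 2 * q * he
    lia
  refine ⟨p + q + d + e, X', Z', ⟨e1, e2, ?_, ?_⟩, hX2, hZ2⟩
  · have h1 : (p * Z) ^ 2 < (w * X) ^ 2 := by
      rw [mul_pow, mul_pow, hX0, hZ0, hw]
      nlinarith [h.nonneg, mul_pos hp (sub_pos.mpr hpq), mul_nonneg hp.le h.nonneg]
    have h2 := (abs_lt_of_sq_lt_sq' h1 (mul_pos hw0 h.pos).le).2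
    linarith
  · by_contra! hneg
    nlinarith [sq_nonneg Z']

theorem PellSol.pred_lt (hp : 0 < p) (hpq : p < q) (hw0 : 2 < w) (hw : w ^ 2 = p * q + 4)
    {d X Z Z' : ℤ} (h : PellSol p q d X Z) (hZ' : 2 * Z' = w * Z - q * X) :
    Z' < Z := by
  have h1 : ((w - 2) * Z) ^ 2 < (q * X) ^ 2 := by
    rw [mul_pow, mul_pow, h.left, h.right]
    have h2 : (w - 2) ^ 2 < p * q := by nlinarith
    have h3 : 0 ≤ q * d := mul_nonneg (by linarith) h.nonneg
    nlinarith
  have := (abs_lt_of_sq_lt_sq' h1 (mul_pos (by linarith) h.pos).le).2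
  linarith

theorem two_mul_recSeq_succ (hw : w ^ 2 = p * q + 4) (σ : ℤ) (i : ℕ) :
    2 * recSeq w 2 (w + σ * p) (i + 1)
        = w * recSeq w 2 (w + σ * p) i + p * recSeq w (2 * σ) (σ * w + q) i ∧
      2 * recSeq w (2 * σ) (σ * w + q) (i + 1)
        = w * recSeq w (2 * σ) (σ * w + q) i + q * recSeq w 2 (w + σ * p) i := by
  induction i with
  | zero => constructor <;> simp only [recSeq] <;> ring
  | succ i ih =>
    simp only [recSeq]
    obtain ⟨h1, h2⟩ := ih
    constructor
    · apply mul_left_cancel₀ (two_ne_zero (α := ℤ))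
      linear_combination w * h1 - p * h2 + recSeq w 2 (w + σ * p) i * hw
    · apply mul_left_cancel₀ (two_ne_zero (α := ℤ))
      linear_combination w * h2 - q * h1 + recSeq w (2 * σ) (σ * w + q) i * hw

/-- Descent: every solution comes from `d = 0`, if the descent cannot end elsewhere. -/
theorem PellSol.exists_eq_recSeq (hp : 0 < p) (hpq : p < q) (hq : 4 < q) (hw0 : 2 < w)
    (hw : w ^ 2 = p * q + 4) (H : ℤ → Prop) (hH : ∀ z n, H z → H (z - q * n))
    (hbase : ∀ d X Z d' X' Z', PellSol p q d X Z → PellSol p q d' X' Z' → 0 < Z → Z' ≤ 0 →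
      2 * Z' = w * Z - q * X → H Z ∨ H Z' → d = 0 ∨ d' = 0)
    {d X Z : ℤ} (h : PellSol p q d X Z) (hZ : 0 < Z) (hHZ : H Z) :
    ∃ i : ℕ, ∃ σ : ℤ, (σ = 1 ∨ σ = -1) ∧ X = recSeq w 2 (w + σ * p) i ∧
      Z = recSeq w (2 * σ) (σ * w + q) i := by
  have main : ∀ n : ℕ, ∀ d X Z : ℤ, PellSol p q d X Z → 0 < Z → Z ≤ n →
      (∀ Z', 2 * Z' = w * Z - q * X → H Z ∨ H Z') →
      ∃ i : ℕ, ∃ σ : ℤ, (σ = 1 ∨ σ = -1) ∧ X = recSeq w 2 (w + σ * p) i ∧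
        Z = recSeq w (2 * σ) (σ * w + q) i := by
    intro n
    induction n with
    | zero => intro d X Z _ h1 h2; exfalso; lia
    | succ n ih =>
      intro d X Z h hZ hn hHZ
      obtain ⟨d', X', Z', h', hX', hZ'⟩ := h.exists_pred hp hpq hq (by linarith) hw
      have hX : 2 * X = w * X' + p * Z' := by
        apply mul_left_cancel₀ (two_ne_zero (α := ℤ))
        linear_combination -w * hX' - p * hZ' - X * hw
      have hZ2 : 2 * Z = w * Z' + q * X' := by
        apply mul_left_cancel₀ (two_ne_zero (α := ℤ))
        linear_combination -w * hZ' - q * hX' - Z * hw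
      have step : ∀ i : ℕ, ∀ σ : ℤ, X' = recSeq w 2 (w + σ * p) i →
          Z' = recSeq w (2 * σ) (σ * w + q) i → X = recSeq w 2 (w + σ * p) (i + 1) ∧
            Z = recSeq w (2 * σ) (σ * w + q) (i + 1) := by
        intro i σ h1 h2
        obtain ⟨h3, h4⟩ := two_mul_recSeq_succ hw σ i
        rw [← h1, ← h2] at h3 h4
        constructor <;> lia
      rcases lt_or_ge 0 Z' with hpos | hneg
      · have := h.pred_lt hp hpq hw0 hw hZ'
        obtain ⟨i, σ, hσ, h1, h2⟩ := ih d' X' Z' h' hpos (by push_cast at hn; lia) (by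
          intro Z'' hZ''
          rcases hHZ Z' hZ' with h3 | h3
          · right
            have := hH _ X' h3
            rwa [show Z - q * X' = Z'' by linarith] at this
          · exact Or.inl h3)
        exact ⟨i + 1, σ, hσ, step i σ h1 h2⟩
      · rcases hbase d X Z d' X' Z' h h' hZ hneg hZ' (hHZ Z' hZ') with rfl | rfl
        · refine ⟨0, 1, Or.inl rfl, ?_, ?_⟩
          · have := h.left; have := h.pos; simp only [recSeq]; nlinarith
          · have := h.right; simp only [recSeq]; nlinarith
        · refine ⟨1, -1, Or.inr rfl, step 0 (-1) ?_ ?_⟩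
          · have := h'.left; have := h'.pos; simp only [recSeq]; nlinarith
          · have := h'.right; simp only [recSeq]; nlinarith
  exact main Z.toNat d X Z h hZ (by lia) fun _ _ => Or.inl hHZ

/-- The equation satisfied where the descent changes sign. -/
theorem PellSol.sq_add_sq_add (hw : w ^ 2 = p * q + 4) {d X Z Z' : ℤ}
    (h : PellSol p q d X Z) (hZ' : 2 * Z' = w * Z - q * X) :
    Z ^ 2 + Z' ^ 2 - w * Z * Z' = q * (q - p) := by
  have h1 := h.left
  have h2 := h.right
  have h3 : q * X = w * Z - 2 * Z' := by linarith
  have h4 : (q * X) ^ 2 = (w * Z - 2 * Z') ^ 2 := by rw [h3]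
  apply mul_left_cancel₀ (four_ne_zero (α := ℤ))
  linear_combination -h4 + q ^ 2 * h1 - p * q * h2 - Z ^ 2 * hw

end descent

section recSeq

variable {p q w : ℤ}

theorem recSeq_left_dvd (hw : w ^ 2 = p * q + 4) (σ : ℤ) (i : ℕ) :
    (i % 2 = 0 → p ∣ recSeq w 2 (w + σ * p) i - 2) ∧
      (i % 2 = 1 → p ∣ recSeq w 2 (w + σ * p) i - w) := by
  induction i using Nat.twoStepInduction with
  | zero => simp [recSeq]
  | one => simp [recSeq]
  | more i ih _ =>
    have h1 := (two_mul_recSeq_succ hw σ (i + 1)).1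
    have h2 : recSeq w 2 (w + σ * p) (i + 2) = recSeq w 2 (w + σ * p) i
        + p * recSeq w (2 * σ) (σ * w + q) (i + 1) := by
      simp only [recSeq] at h1 ⊢; linarith
    simp only [Nat.add_mod_right, h2, add_sub_right_comm _ (p * _)]
    exact ⟨fun h => (ih.1 h).add (dvd_mul_right _ _), fun h => (ih.2 h).add (dvd_mul_right _ _)⟩

theorem recSeq_right_dvd (hw : w ^ 2 = p * q + 4) (σ : ℤ) (i : ℕ) :
    (i % 2 = 0 → q ∣ recSeq w (2 * σ) (σ * w + q) i - 2 * σ) ∧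
      (i % 2 = 1 → q ∣ recSeq w (2 * σ) (σ * w + q) i - σ * w) := by
  induction i using Nat.twoStepInduction with
  | zero => simp [recSeq]
  | one => simp [recSeq]
  | more i ih _ =>
    have h1 := (two_mul_recSeq_succ hw σ (i + 1)).2
    have h2 : recSeq w (2 * σ) (σ * w + q) (i + 2) = recSeq w (2 * σ) (σ * w + q) i
        + q * recSeq w 2 (w + σ * p) (i + 1) := by
      simp only [recSeq] at h1 ⊢; linarith
    simp only [Nat.add_mod_right, h2, add_sub_right_comm _ (q * _)]
    exact ⟨fun h => (ih.1 h).add (dvd_mul_right _ _), fun h => (ih.2 h).add (dvd_mul_right _ _)⟩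

end recSeq

namespace PellSol

variable {X' Z' d' p q w d X Z : ℤ}

/-- The descent cannot end at positive parameters when `q - p` is less than `w`. -/
theorem eq_zero_of_sub_lt (hp : 0 < p) (hpq : p < q) (hw : w ^ 2 = p * q + 4) (hlt : q - p < w)
    (h : PellSol p q d X Z) (h' : PellSol p q d' X' Z') (hZ : 0 < Z) (hZ0 : Z' ≤ 0)
    (hZ' : 2 * Z' = w * Z - q * X) : d = 0 ∨ d' = 0 := by
  by_contra! hd
  have h1 := h.sq_add_sq_add hw hZ'
  have hd1 : 1 ≤ d := by have := h.nonneg; lia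
  have hd2 : 1 ≤ d' := by have := h'.nonneg; lia
  have h2 : q < Z ^ 2 := by rw [h.right]; nlinarith
  have h3 : q < Z' ^ 2 := by rw [h'.right]; nlinarith
  have h4 : q < Z * -Z' := by
    have : q ^ 2 < (Z * -Z') ^ 2 := by nlinarith
    exact lt_of_pow_lt_pow_left₀ 2 (mul_nonneg hZ.le (by linarith)) this
  nlinarith

/-- The residues modulo `q` occurring along the orbit of the trivial solution. -/
def Residue (q w z : ℤ) : Prop := q ∣ z - 2 ∨ q ∣ z + 2 ∨ q ∣ z - w ∨ q ∣ z + w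

theorem Residue.sub_mul {z : ℤ} (h : Residue q w z) (n : ℤ) : Residue q w (z - q * n) := by
  have hn : q ∣ q * n := dvd_mul_right q n
  unfold Residue at *
  simp only [sub_right_comm z (q * n), sub_add_eq_add_sub z (q * n)]
  rcases h with h | h | h | h
  · exact Or.inl (h.sub hn)
  · exact Or.inr (Or.inl (h.sub hn))
  · exact Or.inr (Or.inr (Or.inl (h.sub hn)))
  · exact Or.inr (Or.inr (Or.inr (h.sub hn)))

theorem Residue.neg {z : ℤ} (h : Residue q w z) : Residue q w (-z) := by
  unfold Residue at *
  rw [← dvd_neg (b := -z - 2), ← dvd_neg (b := -z + 2), ← dvd_neg (b := -z - w),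
    ← dvd_neg (b := -z + w)]
  ring_nf at h ⊢
  tauto

theorem eq_or_eq_of_dvd {x y : ℤ} (hx : 0 < x) (hy : 0 < y) (hxy : x + y < q)
    (h : q ∣ x - y ∨ q ∣ x + y) : x = y := by
  rcases h with h | h
  · have := Int.eq_zero_of_abs_lt_dvd h (by rw [abs_lt]; constructor <;> linarith)
    linarith
  · have := Int.le_of_dvd (by linarith) h
    linarith

theorem Residue.eq_or_eq {z : ℤ} (h : Residue q w z) (hw : 2 < w)
    (hwq : 2 * w ≤ q) (hz : 0 < z) (hzq : 2 * z < q) : z = 2 ∨ z = w := by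
  have h' : (q ∣ z - 2 ∨ q ∣ z + 2) ∨ (q ∣ z - w ∨ q ∣ z + w) := by
    unfold Residue at h; tauto
  refine h'.imp (eq_or_eq_of_dvd hz ?_ ?_) (eq_or_eq_of_dvd hz ?_ ?_) <;> lia

theorem ne_two_and_ne (hp : 0 < p) (hq : 0 < q) (hw : w ^ 2 = p * q + 4) (h : PellSol p q d X Z)
    (hd : d ≠ 0) : Z ≠ 2 ∧ Z ≠ w := by
  have h1 := h.left
  have h2 := h.right
  constructor
  · rintro rfl
    have : q * d = 0 := by linarith
    simp_all
  · rintro rfl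
    have : d = p := by
      apply mul_left_cancel₀ hq.ne'
      linarith
    subst this
    have := h.pos
    have : d < X := by nlinarith
    obtain h3 | h3 : X = d + 1 ∨ d + 2 ≤ X := by lia
    · subst h3
      ring_nf at h1
      lia
    · nlinarith

theorem two_mul_lt (hp : 0 < p) (hpq : p < q) (hw0 : 0 < w) (hw : w ^ 2 = p * q + 4) {y z : ℤ}
    (hy : 5 * q ≤ p * y ^ 2) (hy0 : 0 < y) (hz : 0 < z)
    (h : z ^ 2 + y ^ 2 + w * z * y = q * (q - p)) : 2 * z < q := by
  have h1 : w * z * y < q ^ 2 := by nlinarith [sq_nonneg z, sq_nonneg y]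
  have h2 : (w * z * y) ^ 2 < (q ^ 2) ^ 2 := by
    have : 0 < w * z * y := by positivity
    nlinarith
  have h3 : p * q * z ^ 2 * (5 * q) ≤ p * (w * z * y) ^ 2 := by
    have e : p * (w * z * y) ^ 2 = w ^ 2 * z ^ 2 * (p * y ^ 2) := by ring
    rw [e]
    have : p * q * z ^ 2 ≤ w ^ 2 * z ^ 2 := by
      rw [hw]; nlinarith [sq_nonneg z]
    have hq : 0 < q := by linarith
    gcongr
  have h4 : (p * q ^ 2) * (5 * z ^ 2) < (p * q ^ 2) * q ^ 2 := by nlinarith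
  have h5 : 5 * z ^ 2 < q ^ 2 := lt_of_mul_lt_mul_left h4 (by positivity)
  nlinarith

/-- The descent cannot end at positive parameters when the residues modulo `q` are small. -/
theorem eq_zero_of_residue (hp : 0 < p) (hpq : p < q) (hw0 : 2 < w)
    (hwq : 2 * w ≤ q) (hw : w ^ 2 = p * q + 4)
    (h : PellSol p q d X Z) (h' : PellSol p q d' X' Z') (hZ : 0 < Z) (hZ0 : Z' ≤ 0)
    (hZ' : 2 * Z' = w * Z - q * X) (hres : Residue q w Z ∨ Residue q w Z') :
    d = 0 ∨ d' = 0 := by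
  by_contra! hd
  have h1 := h.sq_add_sq_add hw hZ'
  have bound : ∀ {e Y z : ℤ}, PellSol p q e Y z → e ≠ 0 → 5 * q ≤ p * z ^ 2 := by
    intro e Y z he he0
    have k1 := he.left
    have k2 := he.pos
    have k3 : 1 ≤ e := by have := he.nonneg; lia
    have k4 : 3 ≤ Y := by nlinarith
    have k5 : 5 ≤ p * e := by nlinarith
    rw [he.right]
    nlinarith
  have hneg : Z' ≠ 0 := by
    rintro rfl
    have := h'.right
    have := h'.nonneg
    nlinarith
  have hw' : 0 < -Z' := by lia
  have h'' : PellSol p q d' X' (-Z') := ⟨h'.left, by rw [neg_sq]; exact h'.right, h'.pos, h'.nonneg⟩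
  rcases hres with hr | hr
  · have := two_mul_lt hp hpq (by linarith) hw (bound h'' hd.2) hw' hZ (by linarith)
    have := hr.eq_or_eq hw0 hwq hZ this
    have := h.ne_two_and_ne hp (by linarith) hw hd.1
    tauto
  · have := two_mul_lt hp hpq (by linarith) hw (bound h hd.1) hZ hw' (by linarith)
    have := hr.neg.eq_or_eq hw0 hwq hw' this
    have := h''.ne_two_and_ne hp (by linarith) hw hd.2
    tauto

end PellSol

theorem not_dvd_sub_two_and_sub {q w z σ τ : ℤ} (hw : 2 < w) (hwq : w + 2 < q)
    (hσ : σ = 1 ∨ σ = -1) (hτ : τ = 1 ∨ τ = -1) (h1 : q ∣ z - 2 * σ) (h2 : q ∣ z - τ * w) :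
    False := by
  have h3 : q ∣ 2 * σ - τ * w := by
    have := dvd_sub h2 h1
    rwa [sub_sub_sub_cancel_left] at this
  have h4 : |2 * σ - τ * w| < q := by
    rcases hσ with rfl | rfl <;> rcases hτ with rfl | rfl <;> rw [abs_lt] <;>
      constructor <;> linarith
  have := Int.eq_zero_of_abs_lt_dvd h3 h4
  rcases hσ with rfl | rfl <;> rcases hτ with rfl | rfl <;> lia

theorem exists_pos_sq_eq {n : ℤ} (hn : 0 < n) (h : IsSquare n) : ∃ x : ℤ, 0 < x ∧ x ^ 2 = n := by
  obtain ⟨x, rfl⟩ := h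
  refine ⟨|x|, abs_pos.mpr fun h0 => ?_, by rw [sq_abs, sq]⟩
  simp [h0] at hn

theorem PellSol.exists_eq_recSeq_of_residue {p q w d X Z : ℤ} (hp : 0 < p) (hpq : p < q)
    (hq : 4 < q) (hw0 : 2 < w) (hwq : 2 * w ≤ q) (hw : w ^ 2 = p * q + 4)
    (h : PellSol p q d X Z) (hZ : 0 < Z) (hres : Residue q w Z) :
    ∃ i : ℕ, ∃ σ : ℤ, (σ = 1 ∨ σ = -1) ∧ X = recSeq w 2 (w + σ * p) i ∧
      Z = recSeq w (2 * σ) (σ * w + q) i :=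
  h.exists_eq_recSeq hp hpq hq hw0 hw (Residue q w) (fun _ n hz => hz.sub_mul n)
    (fun _ _ _ _ _ _ h1 h2 h3 h4 h5 => eq_zero_of_residue hp hpq hw0 hwq hw h1 h2 h3 h4 h5) hZ
    hres

/-- An extension of a `D(4)`-triple `{a, b, a + b + 2 * r}` is a common term of two
recursive sequences. -/
theorem exists_common_term {a b r d : ℤ} (ha : 0 < a) (hr : 2 < r) (hab : r ^ 2 = a * b + 4)
    (hb : 2 * (a + r) ≤ b) (hd : 0 < d) (h1 : IsSquare (a * d + 4)) (h2 : IsSquare (b * d + 4))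
    (h3 : IsSquare ((a + b + 2 * r) * d + 4)) :
    ∃ x σ τ : ℤ, ∃ l m : ℕ, x ^ 2 = a * d + 4 ∧ 0 < x ∧ (σ = 1 ∨ σ = -1) ∧ (τ = 1 ∨ τ = -1) ∧
      l % 2 = m % 2 ∧ x = recSeq r 2 (r + σ * a) l ∧
      x = recSeq (r + a) 2 (r + a + τ * a) m := by
  obtain ⟨x, hx, hx2⟩ := exists_pos_sq_eq (by positivity) h1
  have hb0 : 0 < b := by linarith
  obtain ⟨y, hy, hy2⟩ := exists_pos_sq_eq (by positivity) h2
  obtain ⟨z, hz, hz2⟩ := exists_pos_sq_eq (by positivity) h3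
  set c := a + b + 2 * r with hc
  have hac : (r + a) ^ 2 = a * c + 4 := by rw [hc]; linear_combination hab
  have hbc : (b + r) ^ 2 = b * c + 4 := by rw [hc]; linear_combination hab
  have hyz : PellSol b c d y z := ⟨hy2, hz2, hy, hd.le⟩
  obtain ⟨j, ρ, hρ, hyj, hzj⟩ := hyz.exists_eq_recSeq hb0 (by linarith) (by linarith)
    (by linarith) hbc (fun _ => True) (fun _ _ _ => trivial)
    (fun _ _ _ _ _ _ k1 k2 k3 k4 k5 _ => PellSol.eq_zero_of_sub_lt hb0 (by linarith) hbc
      (by linarith) k1 k2 k3 k4 k5) hz trivial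
  have hyd := recSeq_left_dvd hbc ρ j
  have hzd := recSeq_right_dvd hbc ρ j
  rw [← hyj] at hyd
  rw [← hzj] at hzd
  have hyd1 : j % 2 = 1 → b ∣ y - r := fun hj => by
    have := (hyd.2 hj).add (dvd_refl b)
    rwa [show y - (b + r) + b = y - r by ring] at this
  have hzd1 : j % 2 = 1 → c ∣ z - -ρ * (r + a) := fun hj => by
    have := (hzd.2 hj).add (dvd_mul_left c ρ)
    rwa [show z - ρ * (b + r) + ρ * c = z - -ρ * (r + a) by rw [hc]; ring] at this
  have hry : PellSol.Residue b r y := by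
    obtain hj | hj := Nat.mod_two_eq_zero_or_one j
    · exact Or.inl (hyd.1 hj)
    · exact Or.inr (Or.inr (Or.inl (hyd1 hj)))
  have hrz : PellSol.Residue c (r + a) z := by
    unfold PellSol.Residue
    obtain hj | hj := Nat.mod_two_eq_zero_or_one j
    · have := hzd.1 hj
      rcases hρ with rfl | rfl <;> norm_num at this <;> tauto
    · have := hzd1 hj
      rcases hρ with rfl | rfl <;>
        simp only [neg_neg, neg_mul, one_mul, sub_neg_eq_add] at this <;> tauto
  obtain ⟨l, σ, hσ, hxl, hyl⟩ := PellSol.exists_eq_recSeq_of_residue (d := d) (X := x) ha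
    (by linarith) (by linarith) hr (by linarith) hab ⟨hx2, hy2, hx, hd.le⟩ hy hry
  obtain ⟨m, τ, hτ, hxm, hzm⟩ := PellSol.exists_eq_recSeq_of_residue (d := d) (X := x) ha
    (by linarith) (by linarith) (by linarith) (by linarith) hac ⟨hx2, hz2, hx, hd.le⟩ hz hrz
  refine ⟨x, σ, τ, l, m, hx2, hx, hσ, hτ, ?_, hxl, hxm⟩
  have hyd' := recSeq_right_dvd hab σ l
  have hzd' := recSeq_right_dvd hac τ m
  rw [← hyl] at hyd'
  rw [← hzm] at hzd'
  obtain hj | hj := Nat.mod_two_eq_zero_or_one j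
  · have hl : l % 2 = 0 := by
      by_contra hl
      exact not_dvd_sub_two_and_sub hr (by linarith) (Or.inl rfl) hσ (hyd.1 hj)
        (hyd'.2 (by lia))
    have hm : m % 2 = 0 := by
      by_contra hm
      exact not_dvd_sub_two_and_sub (by linarith) (by linarith) hρ hτ (hzd.1 hj)
        (hzd'.2 (by lia))
    lia
  · have hl : l % 2 = 1 := by
      by_contra hl
      exact not_dvd_sub_two_and_sub hr (by linarith) hσ (Or.inl rfl) (hyd'.1 (by lia))
        (by rw [one_mul]; exact hyd1 hj)
    have hm : m % 2 = 1 := by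
      by_contra hm
      exact not_dvd_sub_two_and_sub (by linarith) (by linarith) hτ
        (by lia) (hzd'.1 (by lia)) (hzd1 hj)
    lia

theorem pellPair_of_le {ε A K : ℤ} (hε : ε = -2 ∨ ε = 2) (hA : 2801 ≤ A) (hK : 0 < K) :
    PellPair A K (A * K + ε) (A * (A + 1) * K + ε * (2 * A + 1)) (A ^ 2 * K + 2 * ε * A)
      ((A + 1) ^ 2 * K + 2 * ε * (A + 1)) where
  le := hA
  pos := hK
  sub_two_le := by lia
  le_add_two := by lia
  left := by rcases hε with rfl | rfl <;> ring
  right := by rcases hε with rfl | rfl <;> ring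
  mul := by rcases hε with rfl | rfl <;> ring
  three_le := by
    have : 2801 * (A + 1) ≤ A * (A + 1) * K := by
      calc 2801 * (A + 1) ≤ A * (A + 1) * 1 := by rw [mul_one]; gcongr
        _ ≤ A * (A + 1) * K := by gcongr; exact hK
    rcases hε with rfl | rfl <;> linarith
  lt := by
    have : 2801 ≤ A * K := by nlinarith
    rcases hε with rfl | rfl <;> nlinarith
  sq_mul_le := by
    have : A * 1 ≤ A * K := by gcongr; exact hK
    rcases hε with rfl | rfl <;> nlinarith

theorem stmt_17 (ε A K d : ℤ) (hε : ε = -2 ∨ ε = 2) (hA : 0 < A) (hK : 0 < K)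
    (h : IsDiophQuadruple 4 K (A ^ 2 * K + 2 * ε * A) ((A + 1) ^ 2 * K + 2 * ε * (A + 1)) d)
    (hd : 2 < d)
    (hirr : 4 * d ≠ (2 * A ^ 2 + 2 * A) ^ 2 * K ^ 3 + ε * (16 * A ^ 3 + 24 * A ^ 2 + 8 * A) * K ^ 2
      + (80 * A ^ 2 + 80 * A + 16) * K + ε * (32 * A + 16)) :
    (ε = -2 → A ≤ 2800) ∧ (ε = 2 → A ≤ 3365) := by
  by_contra hcon
  have hA' : 2801 ≤ A := by lia
  have hP := pellPair_of_le hε hA' hK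
  obtain ⟨-, -, -, -, -, -, -, -, -, -, -, -, h1, -, h2, h3⟩ := h
  have hc : (A + 1) ^ 2 * K + 2 * ε * (A + 1)
      = K + (A ^ 2 * K + 2 * ε * A) + 2 * (A * K + ε) := by ring
  rw [hc] at h3
  obtain ⟨x, σ, τ, l, m, hx, hx0, hσ, hτ, hlm, hl, hm⟩ := exists_common_term (d := d) hK
    (by linarith [hP.r_ge]) (by linarith [hP.left]) (by
      have := hP.sq_mul_le
      have := hP.le_add_two
      have : (2 * A + 6) * K ≤ (A - 3) ^ 2 * K := by gcongr; nlinarith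
      linarith) (by linarith) h1 h2 h3
  refine hP.false_of_add_two_le hσ hτ (hl.symm.trans hm)
    (hP.add_two_le hσ hτ hlm (hl.symm.trans hm) ?_ ?_) <;> rw [← hl]
  · rintro rfl
    have : 0 < K * d := by positivity
    linarith
  · rintro rfl
    refine hirr (mul_left_cancel₀ hK.ne' ?_)
    rcases hε with rfl | rfl <;> linear_combination -4 * hx
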